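/- Fix m, n ∈ ℕ, q ∈ [2,∞], let p be the conjugate exponent of q (1/p + 1/q = 1), let μ be an isotropic Borel measure on S^{m−1}, and let X = X_p(μ) = (ℝ^m, ‖·‖_{p,μ}), with dual space X*. Then for every pair of unit vectors θ = (θ_1,…,θ_n) and φ = (φ_1,…,φ_n) in ℝ^n, if (θ_1²,…,θ_n²) is majorized by (φ_1²,…,φ_n²), then the mean widths satisfy w(Proj_{H_θ}(B_q^n(X*))) ≥ w(Proj_{H_φ}(B_q^n(X*))). -/

import Mathlib

open MeasureTheory Real Filter
open scoped ENNReal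

noncomputable section

/-- `N` is a quasi-norm on `ℝ^m`. -/
def IsQuasiNorm (m : ℕ) (N : (Fin m → ℝ) → ℝ) : Prop :=
  (∀ x, 0 ≤ N x) ∧ (∀ x, N x = 0 ↔ x = 0) ∧
    (∀ (a : ℝ) (x : Fin m → ℝ), N (a • x) = |a| * N x) ∧
    ∃ C : ℝ, 1 ≤ C ∧ ∀ x y, N (x + y) ≤ C * (N x + N y)

/-- `X = (ℝ^m, N)` admits an isometric embedding into some `L_p(μ)` space:
there are a measure space `(Ω, μ)` and a linear map `T : ℝ^m → L_p(μ)` with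
`‖T x‖_{L_p(μ)} = N x` for every `x`. -/
def EmbedsIntoLp (m : ℕ) (p : ℝ) (N : (Fin m → ℝ) → ℝ) : Prop :=
  ∃ (Ω : Type) (_ : MeasurableSpace Ω) (μ : Measure Ω) (T : (Fin m → ℝ) →ₗ[ℝ] (Ω → ℝ)),
    (∀ x, Integrable (fun ω => |T x ω| ^ p) μ) ∧
    ∀ x, (∫ ω, |T x ω| ^ p ∂μ) ^ (1 / p) = N x

/-- `α` is majorized by `β`: for every `k`, the sum of the `k` largest entries of `α` is at
most that of `β` (expressed via finite subsets: the sum of the `k` largest entries is the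
maximum of `∑ i ∈ A, · i` over sets `A` of cardinality `k`), and the total sums agree. -/
def IsMajorizedBy {n : ℕ} (α β : Fin n → ℝ) : Prop :=
  (∀ A : Finset (Fin n), ∃ B : Finset (Fin n), B.card = A.card ∧ ∑ i ∈ A, α i ≤ ∑ i ∈ B, β i) ∧
    ∑ i, α i = ∑ i, β i

/-- The unit ball `B_p^n(X)` of `ℓ_p^n(X)` for `X = (ℝ^m, N)` and `0 < p < ∞`. -/
def lpBall (m n : ℕ) (p : ℝ) (N : (Fin m → ℝ) → ℝ) : Set (Fin n × Fin m → ℝ) :=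
  {x | ∑ i : Fin n, N (fun j => x (i, j)) ^ p ≤ 1}

/-- The block hyperplane `H_θ = {(x_1,…,x_n) ∈ (ℝ^m)^n : ∑ θ_i x_i = 0}`. -/
def blockHyp (m n : ℕ) (θ : Fin n → ℝ) : Set (Fin n × Fin m → ℝ) :=
  {x | ∀ j : Fin m, ∑ i : Fin n, θ i * x (i, j) = 0}

/-- `ι` is a linear isometric parametrization (w.r.t. the Euclidean structures) of the
subspace `H` of `ℝ^{mn} = (ℝ^m)^n` by `ℝ^d`; for `A ⊆ H`, `volume (⇑ι ⁻¹' A)` is then the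
`d`-dimensional Lebesgue measure of `A` inside `H`. -/
def IsEuclParam (m n d : ℕ) (ι : (Fin d → ℝ) →ₗ[ℝ] (Fin n × Fin m → ℝ))
    (H : Set (Fin n × Fin m → ℝ)) : Prop :=
  (∀ y, ∑ c, ι y c ^ 2 = ∑ i, y i ^ 2) ∧ Set.range ⇑ι = H

/-- The norm of `X_p(μ)` for a Borel measure `μ` on the unit sphere `S^{m-1}`:
`‖x‖_{p,μ} = (∫_{S^{m-1}} |⟨x,u⟩|^p dμ(u))^{1/p}`. -/
def lewisNorm (m : ℕ) (p : ℝ) (μ : Measure (Metric.sphere (0 : EuclideanSpace ℝ (Fin m)) 1))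
    (x : Fin m → ℝ) : ℝ :=
  (∫ u, |∑ k, x k * (u : EuclideanSpace ℝ (Fin m)) k| ^ p ∂μ) ^ (1 / p)

/-- `μ` is an isotropic measure on the sphere `S^{m-1}`. -/
def IsIsotropic (m : ℕ) (μ : Measure (Metric.sphere (0 : EuclideanSpace ℝ (Fin m)) 1)) : Prop :=
  ∀ x : Fin m → ℝ, ∑ k, x k ^ 2 = ∫ u, (∑ k, x k * (u : EuclideanSpace ℝ (Fin m)) k) ^ 2 ∂μ

/-- The dual norm of a norm `N` on `ℝ^m` (w.r.t. the standard inner product). -/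
def dualNorm (m : ℕ) (N : (Fin m → ℝ) → ℝ) (y : Fin m → ℝ) : ℝ :=
  sSup ((fun x => ∑ k, x k * y k) '' {x | N x ≤ 1})

/-- The unit ball `B_q^n(Y)` of `ℓ_q^n(Y)` for `Y = (ℝ^m, N)` and `q ∈ (0,∞]`. -/
def lqBallE (m n : ℕ) (q : ℝ≥0∞) (N : (Fin m → ℝ) → ℝ) : Set (Fin n × Fin m → ℝ) :=
  if q = ⊤ then {x | ∀ i : Fin n, N (fun j => x (i, j)) ≤ 1}
  else {x | ∑ i : Fin n, N (fun j => x (i, j)) ^ q.toReal ≤ 1}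

/-- The mean width of `A ⊆ H ⊆ ℝ^{mn}` computed inside the subspace `H` parametrized by the
Euclidean isometry `ι : ℝ^d → H`: `w(A) = 2 ⨍_{S(H)} h_A(u) dσ(u)`, where `σ` is the
rotation-invariant probability measure on the unit sphere of `H`, realized as the normalized
`(d-1)`-dimensional Hausdorff measure on the unit sphere of `ℝ^d`. -/
def meanWidthIn (m n d : ℕ) (ι : EuclideanSpace ℝ (Fin d) →ₗ[ℝ] (Fin n × Fin m → ℝ))
    (A : Set (Fin n × Fin m → ℝ)) : ℝ :=
  2 * ⨍ u in Metric.sphere (0 : EuclideanSpace ℝ (Fin d)) 1,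
        sSup ((fun x => ∑ c, x c * ι u c) '' A) ∂μH[(d : ℝ) - 1]

/-- A function convex on a set containing the finite set `G` agrees on any `F ⊆ G` with an affine
function plus a nonnegative combination of hinge functions `x ↦ max (x - t) 0`, which moreover
bounds it from below at the points of `G` to the right of `F`. -/
theorem ConvexOn.exists_hinge_representation {s : Set ℝ} {ψ : ℝ → ℝ} (hψ : ConvexOn ℝ s ψ)
    (G : Finset ℝ) (hG : ∀ x ∈ G, x ∈ s) (F : Finset ℝ) (hF : F ⊆ G) :
    ∃ (a b : ℝ) (w : ℝ → ℝ), (∀ t, 0 ≤ w t) ∧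
      (∀ x ∈ F, ψ x = a + b * x + ∑ t ∈ F, w t * max (x - t) 0) ∧
      (F.Nonempty → ∀ x ∈ G, (∀ t ∈ F, t ≤ x) →
        a + b * x + ∑ t ∈ F, w t * max (x - t) 0 ≤ ψ x) := by
  classical
  induction F using Finset.induction_on_max with
  | empty => exact ⟨0, 0, 0, by simp, by simp, by simp⟩
  | insert M F hM ih =>
    have hMG : M ∈ G := hF (Finset.mem_insert_self _ _)
    have hMF : M ∉ F := fun h => lt_irrefl _ (hM M h)
    rcases F.eq_empty_or_nonempty with rfl | hne
    · obtain ⟨b, hb⟩ := (G.image fun x => slope ψ M x).bddBelow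
      refine ⟨ψ M - b * M, b, 0, by simp, by simp, fun _ x hx hMx => ?_⟩
      have hMx' : M ≤ x := hMx M (by simp)
      rcases hMx'.eq_or_lt with rfl | hlt
      · simp
      · have : b ≤ slope ψ M x := hb (Finset.mem_coe.2 (Finset.mem_image_of_mem _ hx))
        rw [slope_def_field, le_div_iff₀ (by linarith)] at this
        simp only [Pi.zero_apply, zero_mul, Finset.sum_const_zero]
        linarith
    · obtain ⟨a, b, w, hw, hrep, hle⟩ := ih fun x hx => hF (Finset.mem_insert_of_mem hx)
      replace hle := hle hne
      set t₀ := F.max' hne with ht₀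
      have ht₀F : t₀ ∈ F := F.max'_mem hne
      have ht₀M : t₀ < M := hM _ ht₀F
      have hle₀ : ∀ t ∈ F, t ≤ t₀ := fun t ht => F.le_max' t ht
      set g : ℝ → ℝ := fun x => a + b * x + ∑ t ∈ F, w t * max (x - t) 0 with hg
      have hgaff : ∀ x, t₀ ≤ x → g x = ψ t₀ + (b + ∑ t ∈ F, w t) * (x - t₀) := by
        intro x hx
        rw [hrep t₀ ht₀F]
        have h1 : ∀ y, t₀ ≤ y → ∑ t ∈ F, w t * max (y - t) 0
            = (∑ t ∈ F, w t) * y - ∑ t ∈ F, w t * t := by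
          intro y hy
          rw [Finset.sum_mul, ← Finset.sum_sub_distrib]
          refine Finset.sum_congr rfl fun t ht => ?_
          rw [max_eq_left (by linarith [hle₀ t ht])]
          ring
        simp only [hg]
        rw [h1 x hx, h1 t₀ le_rfl]
        ring
      have hgM : g M ≤ ψ M := hle M hMG fun t ht => (hM t ht).le
      set δ := (ψ M - g M) / (M - t₀) with hδ
      have hδ0 : 0 ≤ δ := div_nonneg (by linarith) (by linarith)
      have hδM : δ * (M - t₀) = ψ M - g M := div_mul_cancel₀ _ (by linarith)
      set w' : ℝ → ℝ := fun t => if t = M then 0 else w t + if t = t₀ then δ else 0 with hw'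
      have hnew : ∀ x, a + b * x + ∑ t ∈ insert M F, w' t * max (x - t) 0
          = g x + δ * max (x - t₀) 0 := by
        intro x
        rw [Finset.sum_insert hMF]
        have : ∑ t ∈ F, w' t * max (x - t) 0
            = ∑ t ∈ F, w t * max (x - t) 0 + δ * max (x - t₀) 0 := by
          rw [show δ * max (x - t₀) 0 = ∑ t ∈ F, if t = t₀ then δ * max (x - t) 0 else 0 by
            rw [Finset.sum_ite_eq' F t₀ (fun t => δ * max (x - t) 0)]; simp [ht₀F],
            ← Finset.sum_add_distrib]
          refine Finset.sum_congr rfl fun t ht => ?_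
          have : t ≠ M := (hM t ht).ne
          simp only [hw', this, if_false]
          split_ifs <;> ring
        rw [this]
        simp only [hw', hg, if_true]
        ring
      refine ⟨a, b, w', ?_, ?_, ?_⟩
      · intro t
        simp only [hw']
        split_ifs
        · exact le_rfl
        · linarith [hw t]
        · linarith [hw t]
      · intro x hx
        rw [hnew]
        rcases Finset.mem_insert.1 hx with rfl | hxF
        · rw [max_eq_left (by linarith)]
          linarith
        · rw [max_eq_right (by linarith [hle₀ x hxF]), hrep x hxF]
          simp [hg]
      · intro _ x hx hxM
        have hMx : M ≤ x := hxM M (Finset.mem_insert_self _ _)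
        rw [hnew, max_eq_left (by linarith), hgaff x (by linarith)]
        rw [hgaff M ht₀M.le] at hδM
        rcases hMx.eq_or_lt with rfl | hlt
        · linarith
        · have hs := hψ.slope_mono_adjacent (hG t₀ (hF (Finset.mem_insert_of_mem ht₀F)))
            (hG x hx) ht₀M hlt
          set c := b + ∑ t ∈ F, w t
          have h1 : (ψ M - ψ t₀) / (M - t₀) = δ + c := by
            rw [div_eq_iff (by linarith)]
            linarith
          rw [h1, le_div_iff₀ (by linarith)] at hs
          nlinarith

/-- **Karamata's inequality**. -/
theorem IsMajorizedBy.sum_le_sum_of_convexOn {n : ℕ} {α β : Fin n → ℝ} (h : IsMajorizedBy α β)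
    {s : Set ℝ} {ψ : ℝ → ℝ} (hψ : ConvexOn ℝ s ψ) (hα : ∀ i, α i ∈ s) (hβ : ∀ i, β i ∈ s) :
    ∑ i, ψ (α i) ≤ ∑ i, ψ (β i) := by
  classical
  set F : Finset ℝ := Finset.univ.image α ∪ Finset.univ.image β with hFdef
  have hαF : ∀ i, α i ∈ F := fun i => by simp [hFdef]
  have hβF : ∀ i, β i ∈ F := fun i => by simp [hFdef]
  obtain ⟨a, b, w, hw, hrep, -⟩ := hψ.exists_hinge_representation F (by
    intro x hx
    simp only [hFdef, Finset.mem_union, Finset.mem_image, Finset.mem_univ, true_and] at hx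
    rcases hx with ⟨i, rfl⟩ | ⟨i, rfl⟩
    exacts [hα i, hβ i]) F subset_rfl
  have hinge : ∀ t, ∑ i, max (α i - t) 0 ≤ ∑ i, max (β i - t) 0 := by
    intro t
    obtain ⟨B, hBc, hB⟩ := h.1 (Finset.univ.filter fun i => t ≤ α i)
    calc ∑ i, max (α i - t) 0 = ∑ i ∈ Finset.univ.filter (fun i => t ≤ α i), (α i - t) := by
          rw [Finset.sum_filter]
          refine Finset.sum_congr rfl fun i _ => ?_
          split_ifs with hi
          · exact max_eq_left (by linarith)
          · exact max_eq_right (by linarith)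
      _ ≤ ∑ i ∈ B, (β i - t) := by
          rw [Finset.sum_sub_distrib, Finset.sum_sub_distrib, Finset.sum_const, Finset.sum_const,
            hBc]
          linarith
      _ ≤ ∑ i ∈ B, max (β i - t) 0 := Finset.sum_le_sum fun i _ => le_max_left _ _
      _ ≤ ∑ i, max (β i - t) 0 :=
          Finset.sum_le_sum_of_subset_of_nonneg (Finset.subset_univ _) fun i _ _ => le_max_right _ _
  rw [Finset.sum_congr rfl fun i _ => hrep _ (hαF i), Finset.sum_congr rfl fun i _ => hrep _ (hβF i)]
  simp only [Finset.sum_add_distrib, ← Finset.mul_sum]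
  rw [h.2, Finset.sum_comm, Finset.sum_comm (s := Finset.univ)]
  refine add_le_add le_rfl ?_
  refine Finset.sum_le_sum fun t _ => ?_
  rw [← Finset.mul_sum, ← Finset.mul_sum]
  exact mul_le_mul_of_nonneg_left (hinge t) (hw t)

theorem integrableOn_one_sub_exp_mul_rpow {a : ℝ} (ha : 0 < a) (ha1 : a < 1) :
    IntegrableOn (fun t : ℝ => (1 - rexp (-t)) * t ^ (-1 - a)) (Set.Ioi 0) := by
  have hcont : ContinuousOn (fun t : ℝ => (1 - rexp (-t)) * t ^ (-1 - a)) (Set.Ioi 0) :=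
    ContinuousOn.mul (by fun_prop)
      (ContinuousOn.rpow_const continuousOn_id fun x hx => Or.inl (ne_of_gt hx))
  rw [← Set.Ioc_union_Ioi_eq_Ioi (zero_le_one (α := ℝ))]
  refine IntegrableOn.union ?_ ?_
  · have h := (intervalIntegral.intervalIntegrable_rpow' (a := 0) (b := 1) (r := -a)
      (by linarith)).1
    refine Integrable.mono h ((hcont.mono Set.Ioc_subset_Ioi_self).aestronglyMeasurable
      measurableSet_Ioc) ?_
    filter_upwards [ae_restrict_mem measurableSet_Ioc] with t ht
    have ht0 : 0 < t := ht.1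
    have h1 : 0 ≤ 1 - rexp (-t) := by linarith [Real.exp_le_one_iff.2 (neg_nonpos.2 ht0.le)]
    have h2 : 1 - rexp (-t) ≤ t := by linarith [Real.add_one_le_exp (-t)]
    rw [Real.norm_of_nonneg (mul_nonneg h1 (Real.rpow_nonneg ht0.le _)),
      Real.norm_of_nonneg (Real.rpow_nonneg ht0.le _)]
    calc (1 - rexp (-t)) * t ^ (-1 - a) ≤ t ^ (1 : ℝ) * t ^ (-1 - a) := by
          rw [Real.rpow_one]
          exact mul_le_mul_of_nonneg_right h2 (Real.rpow_nonneg ht0.le _)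
      _ = t ^ (-a) := by rw [← Real.rpow_add ht0]; ring_nf
  · have h := integrableOn_Ioi_rpow_of_lt (a := -1 - a) (by linarith) (c := 1) one_pos
    refine Integrable.mono h ((hcont.mono (Set.Ioi_subset_Ioi zero_le_one)).aestronglyMeasurable
      measurableSet_Ioi) ?_
    filter_upwards [ae_restrict_mem measurableSet_Ioi] with t ht
    have ht0 : 0 < t := one_pos.trans ht
    have h1 : 0 ≤ 1 - rexp (-t) := by linarith [Real.exp_le_one_iff.2 (neg_nonpos.2 ht0.le)]
    have h2 : 1 - rexp (-t) ≤ 1 := by linarith [Real.exp_pos (-t)]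
    rw [norm_mul, Real.norm_of_nonneg h1]
    exact mul_le_of_le_one_left (norm_nonneg _) h2

/-- For `0 < a ≤ 1` the function `y ↦ y ^ a` is the limit from below of functions
`y ↦ ∫ (1 - exp (-t y)) dν(t)` with `ν` a finite measure. -/
theorem exists_measure_tendsto_integral_one_sub_exp {a : ℝ} (ha : 0 < a) (ha1 : a ≤ 1) :
    ∃ ν : ℕ → Measure NNReal, (∀ k, IsFiniteMeasure (ν k)) ∧
      (∀ y : ℝ, 0 ≤ y → ∀ k, ∫ t, (1 - rexp (-(t * y))) ∂ν k ≤ y ^ a) ∧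
      ∀ y : ℝ, 0 ≤ y →
        Tendsto (fun k => ∫ t, (1 - rexp (-(t * y))) ∂ν k) atTop (nhds (y ^ a)) := by
  rcases ha1.eq_or_lt with rfl | ha1
  · refine ⟨fun k => ((k : NNReal) + 1) • Measure.dirac (((k : NNReal) + 1)⁻¹),
      fun k => inferInstance, fun y hy k => ?_, fun y hy => ?_⟩
    · have hk : (0 : ℝ) < k + 1 := by positivity
      rw [integral_smul_nnreal_measure, integral_dirac, NNReal.smul_def, Real.rpow_one]
      push_cast
      rw [smul_eq_mul]
      have := Real.add_one_le_exp (-(((k : ℝ) + 1)⁻¹ * y))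
      calc ((k : ℝ) + 1) * (1 - rexp (-(((k : ℝ) + 1)⁻¹ * y)))
          ≤ ((k : ℝ) + 1) * (((k : ℝ) + 1)⁻¹ * y) := by gcongr; linarith
        _ = y := by field_simp
    · have hd : HasDerivAt (fun s : ℝ => 1 - rexp (-(s * y))) y 0 := by
        have h1 : HasDerivAt (fun s : ℝ => -(s * y)) (-(1 * y)) 0 :=
          ((hasDerivAt_id (0 : ℝ)).mul_const y).neg
        have := (h1.exp).const_sub 1
        simpa using this
      have ht : Tendsto (fun k : ℕ => ((k : ℝ) + 1)⁻¹) atTop (nhdsWithin 0 {0}ᶜ) := by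
        refine tendsto_nhdsWithin_iff.2 ⟨?_, Eventually.of_forall fun k => ?_⟩
        · simpa using tendsto_one_div_add_atTop_nhds_zero_nat (𝕜 := ℝ)
        · have : (0 : ℝ) < k + 1 := by positivity
          simpa using this.ne'
      have := (hasDerivAt_iff_tendsto_slope.1 hd).comp ht
      rw [Real.rpow_one]
      refine this.congr fun k => ?_
      rw [integral_smul_nnreal_measure, integral_dirac, NNReal.smul_def]
      simp [slope_def_field]
      ring
  · set φ : ℝ → ℝ := fun t => (1 - rexp (-t)) * t ^ (-1 - a) with hφ
    have hφi := integrableOn_one_sub_exp_mul_rpow ha ha1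
    have hpos : ∀ t y : ℝ, 0 ≤ t → 0 ≤ y → 0 ≤ 1 - rexp (-(t * y)) := fun t y ht hy => by
      linarith [Real.exp_le_one_iff.2 (neg_nonpos.2 (mul_nonneg ht hy))]
    set C := ∫ t in Set.Ioi (0 : ℝ), φ t with hC
    have hCpos : 0 < C := by
      rw [hC, setIntegral_pos_iff_support_of_nonneg_ae _ hφi]
      · have : Set.Ioi (0 : ℝ) ⊆ Function.support φ ∩ Set.Ioi 0 := by
          refine fun t ht => ⟨?_, ht⟩
          have ht' : (0 : ℝ) < t := ht
          have : rexp (-t) < 1 := by rw [Real.exp_lt_one_iff]; linarith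
          exact (mul_pos (by linarith) (Real.rpow_pos_of_pos ht' _)).ne'
        refine lt_of_lt_of_le ?_ (measure_mono this)
        simp
      · filter_upwards [ae_restrict_mem measurableSet_Ioi] with t ht
        have := hpos t 1 (le_of_lt ht) zero_le_one
        rw [mul_one] at this
        exact mul_nonneg this (Real.rpow_nonneg (le_of_lt ht) _)
    have hscale : ∀ y : ℝ, 0 < y → ∀ t ∈ Set.Ioi (0 : ℝ),
        (1 - rexp (-(t * y))) * t ^ (-1 - a) = y ^ (1 + a) * φ (t * y) := by
      intro y hy t ht
      have ht' : (0 : ℝ) < t := ht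
      simp only [hφ]
      rw [Real.mul_rpow ht'.le hy.le, show -1 - a = -(1 + a) by ring, Real.rpow_neg hy.le]
      field_simp
    have hint : ∀ y : ℝ, 0 ≤ y →
        IntegrableOn (fun t => (1 - rexp (-(t * y))) * t ^ (-1 - a)) (Set.Ioi 0) ∧
        ∫ t in Set.Ioi (0 : ℝ), (1 - rexp (-(t * y))) * t ^ (-1 - a) = y ^ a * C := by
      intro y hy
      rcases hy.eq_or_lt with rfl | hy
      · simp [Real.zero_rpow ha.ne']
      · refine ⟨(integrableOn_congr_fun (hscale y hy) measurableSet_Ioi).2 ?_, ?_⟩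
        · have := (integrableOn_Ioi_comp_mul_right_iff φ 0 hy).2 (by simpa using hφi)
          exact this.const_mul _
        · rw [setIntegral_congr_fun measurableSet_Ioi (hscale y hy), integral_const_mul,
            integral_comp_mul_right_Ioi φ 0 hy, zero_mul, smul_eq_mul, Real.rpow_add hy,
            Real.rpow_one, ← hC]
          field_simp
    have hε : ∀ k : ℕ, (0 : ℝ) < ((k : ℝ) + 1)⁻¹ := fun k => by positivity
    have hform : ∀ y : ℝ, 0 ≤ y → ∀ k : ℕ,
        ∫ t, (1 - rexp (-(t * y))) ∂(Measure.map Real.toNNReal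
          ((volume.restrict (Set.Ioi ((k : ℝ) + 1)⁻¹)).withDensity
            fun t => ENNReal.ofReal (t ^ (-1 - a) / C))) =
        (∫ t in Set.Ioi ((k : ℝ) + 1)⁻¹, (1 - rexp (-(t * y))) * t ^ (-1 - a)) / C := by
      intro y hy k
      rw [integral_map (by fun_prop) (by fun_prop),
        integral_withDensity_eq_integral_toReal_smul (by fun_prop) (by simp),
        ← integral_div]
      refine setIntegral_congr_fun measurableSet_Ioi fun t ht => ?_
      have ht' : (0 : ℝ) < t := (hε k).trans ht
      rw [ENNReal.toReal_ofReal (div_nonneg (Real.rpow_nonneg ht'.le _) hCpos.le),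
        Real.coe_toNNReal _ ht'.le, smul_eq_mul]
      ring
    refine ⟨fun k => Measure.map Real.toNNReal
          ((volume.restrict (Set.Ioi ((k : ℝ) + 1)⁻¹)).withDensity
            fun t => ENNReal.ofReal (t ^ (-1 - a) / C)), fun k => ?_, fun y hy k => ?_,
            fun y hy => ?_⟩
    · have : IsFiniteMeasure ((volume.restrict (Set.Ioi ((k : ℝ) + 1)⁻¹)).withDensity
            fun t => ENNReal.ofReal (t ^ (-1 - a) / C)) :=
        isFiniteMeasure_withDensity_ofReal
          ((integrableOn_Ioi_rpow_of_lt (by linarith) (hε k)).div_const C).2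
      infer_instance
    · rw [hform y hy k, div_le_iff₀ hCpos, ← (hint y hy).2]
      refine setIntegral_mono_set (hint y hy).1 ?_
        (Set.Ioi_subset_Ioi (hε k).le).eventuallyLE
      filter_upwards [ae_restrict_mem measurableSet_Ioi] with t ht
      exact mul_nonneg (hpos t y (le_of_lt ht) hy) (Real.rpow_nonneg (le_of_lt ht) _)
    · simp only [hform y hy]
      have hlim : Tendsto (fun k : ℕ => ((k : ℝ) + 1)⁻¹) atTop (nhds 0) := by
        simpa using tendsto_one_div_add_atTop_nhds_zero_nat (𝕜 := ℝ)
      have hU : Set.Ioi (0 : ℝ) = ⋃ k : ℕ, Set.Ioi ((k : ℝ) + 1)⁻¹ := by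
        ext t
        simp only [Set.mem_Ioi, Set.mem_iUnion]
        exact ⟨fun ht => (hlim.eventually_lt_const ht).exists, fun ⟨k, hk⟩ => (hε k).trans hk⟩
      have := tendsto_setIntegral_of_monotone (μ := volume)
        (s := fun k : ℕ => Set.Ioi ((k : ℝ) + 1)⁻¹)
        (f := fun t => (1 - rexp (-(t * y))) * t ^ (-1 - a)) (fun _ => measurableSet_Ioi)
        (fun i j hij => Set.Ioi_subset_Ioi (by gcongr)) (by rw [← hU]; exact (hint y hy).1)
      rw [← hU, (hint y hy).2] at this
      simpa [hCpos.ne'] using this.div_const C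

/-- The unnormalized standard Gaussian density. -/
def gaussWeight {ι : Type*} [Fintype ι] (x : ι → ℝ) : ℝ := rexp (-(1 / 2) * ∑ j, x j ^ 2)

theorem gaussWeight_pos {ι : Type*} [Fintype ι] (x : ι → ℝ) : 0 < gaussWeight x := Real.exp_pos _

@[fun_prop]
theorem continuous_gaussWeight {ι : Type*} [Fintype ι] :
    Continuous (gaussWeight : (ι → ℝ) → ℝ) := by
  unfold gaussWeight
  fun_prop

@[fun_prop]
theorem measurable_gaussWeight {ι : Type*} [Fintype ι] :
    Measurable (gaussWeight : (ι → ℝ) → ℝ) := continuous_gaussWeight.measurable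

theorem integrable_exp_neg_mul_sum_sq {ι : Type*} [Fintype ι] {b : ℝ} (hb : 0 < b) :
    Integrable (fun x : ι → ℝ => rexp (-b * ∑ j, x j ^ 2)) := by
  have h := Integrable.fintype_prod (ι := ι) (μ := fun _ => volume)
    (f := fun _ x => rexp (-b * x ^ 2)) fun _ => integrable_exp_neg_mul_sq hb
  refine h.congr (Eventually.of_forall fun x => ?_)
  simp only
  rw [← Real.exp_sum, Finset.mul_sum]

theorem integrable_gaussWeight {ι : Type*} [Fintype ι] :
    Integrable (gaussWeight : (ι → ℝ) → ℝ) := integrable_exp_neg_mul_sum_sq (by norm_num)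

theorem integral_gaussWeight_mul_cexp {ι : Type*} [Fintype ι] (ξ : ι → ℝ) :
    ∫ x : ι → ℝ, (gaussWeight x : ℂ) * Complex.exp ((∑ j, ξ j * x j : ℝ) * Complex.I) =
      (((2 * π) ^ ((Fintype.card ι : ℝ) / 2) * gaussWeight ξ : ℝ) : ℂ) := by
  have h := GaussianFourier.integral_cexp_neg_mul_sum_add (ι := ι) (b := 1 / 2) (by norm_num)
    fun j => (ξ j : ℂ) * Complex.I
  have h2 : (π : ℂ) / (1 / 2) = ((2 * π : ℝ) : ℂ) := by push_cast; ring
  rw [h2] at h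
  rw [Complex.ofReal_mul, Complex.ofReal_cpow (by positivity)]
  convert h using 1
  · refine integral_congr_ae (Eventually.of_forall fun x => ?_)
    simp only [gaussWeight]
    rw [Complex.ofReal_exp, ← Complex.exp_add]
    push_cast
    congr 2
    rw [Finset.sum_mul]
    exact Finset.sum_congr rfl fun j _ => by ring
  · congr 1
    · push_cast; rfl
    · simp only [gaussWeight, mul_pow, Complex.I_sq, ← Finset.sum_mul]
      rw [Complex.ofReal_exp]
      congr 1
      push_cast
      ring

/-- The Fourier transform of a centred Gaussian density on a line. -/
theorem Matrix.PosSemidef.integral_exp_neg_mul_cexp {m : ℕ} {M : Matrix (Fin m) (Fin m) ℝ}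
    (hM : M.PosSemidef) (ξ : Fin m → ℝ) :
    ∃ c : ℝ, 0 < c ∧ ∃ d : ℝ, ∀ s : ℝ,
      ∫ x : Fin m → ℝ, ((rexp (-(x ⬝ᵥ M.mulVec x)) * gaussWeight x : ℝ) : ℂ) *
        Complex.exp ((s * ∑ j, ξ j * x j : ℝ) * Complex.I) = ((c * rexp (-(s ^ 2 * d)) : ℝ) : ℂ) := by
  set b := hM.isHermitian.eigenvectorBasis
  set l := hM.isHermitian.eigenvalues
  have hl : ∀ j, 0 ≤ l j := fun j => hM.eigenvalues_nonneg j
  set e : (Fin m → ℝ) → (Fin m → ℝ) := fun y => WithLp.ofLp (b.repr.symm (WithLp.toLp 2 y)) with he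
  have hemp : MeasurePreserving e := (PiLp.volume_preserving_ofLp _).comp
    (b.measurePreserving_repr_symm.comp (PiLp.volume_preserving_toLp _))
  have heme : MeasurableEmbedding e := by
    refine (MeasurableEquiv.measurableEmbedding
      ((MeasurableEquiv.toLp 2 (Fin m → ℝ)).trans
        (b.repr.symm.toMeasurableEquiv.trans (MeasurableEquiv.toLp 2 (Fin m → ℝ)).symm)))
  have hdot : ∀ y z : Fin m → ℝ, e y ⬝ᵥ z = ∑ j, y j * b.repr (WithLp.toLp 2 z) j := by
    intro y z
    have h1 : e y ⬝ᵥ z = inner ℝ (b.repr.symm (WithLp.toLp 2 y)) (WithLp.toLp 2 z) := by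
      simp [he, PiLp.inner_apply, dotProduct, mul_comm]
    rw [h1, ← b.repr.inner_map_map, LinearIsometryEquiv.apply_symm_apply]
    simp [PiLp.inner_apply, mul_comm]
  have hee : ∀ y, b.repr (WithLp.toLp 2 (e y)) = WithLp.toLp 2 y := fun y => by simp [he]
  have hMe : ∀ y j, b.repr (WithLp.toLp 2 (M.mulVec (e y))) j = l j * y j := by
    intro y j
    have h1 : b.repr (WithLp.toLp 2 (M.mulVec (e y))) j =
        WithLp.ofLp (b j) ⬝ᵥ M.mulVec (e y) := by
      rw [b.repr_apply_apply]
      simp [PiLp.inner_apply, dotProduct, mul_comm]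
    have hsymm : M.vecMul (WithLp.ofLp (b j)) = M.mulVec (WithLp.ofLp (b j)) := by
      rw [← Matrix.mulVec_transpose]
      congr 1
      simpa using hM.isHermitian.eq
    have h2 : WithLp.ofLp (b j) ⬝ᵥ e y = y j := by
      have h3 : b.repr (WithLp.toLp 2 (e y)) j = WithLp.ofLp (b j) ⬝ᵥ e y := by
        rw [b.repr_apply_apply]
        simp [PiLp.inner_apply, dotProduct, mul_comm]
      rw [← h3, hee]
    rw [h1, Matrix.dotProduct_mulVec, hsymm, hM.isHermitian.mulVec_eigenvectorBasis,
      smul_dotProduct, h2, smul_eq_mul]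
  have hl2 : ∀ j, 0 < l j + 1 / 2 := fun j => by linarith [hl j]
  set η : Fin m → ℝ := fun j => b.repr (WithLp.toLp 2 ξ) j with hη
  refine ⟨∏ j, (π / (l j + 1 / 2)) ^ (1 / 2 : ℝ), Finset.prod_pos fun j _ =>
    Real.rpow_pos_of_pos (div_pos Real.pi_pos (hl2 j)) _, ∑ j, η j ^ 2 / (4 * (l j + 1 / 2)),
    fun s => ?_⟩
  rw [← hemp.integral_comp heme]
  have h := GaussianFourier.integral_cexp_neg_sum_mul_add (b := fun j => ((l j + 1 / 2 : ℝ) : ℂ))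
    (fun j => by simpa using hl2 j) fun j => (s * η j : ℂ) * Complex.I
  convert h using 1
  · refine integral_congr_ae (Eventually.of_forall fun y => ?_)
    have h1 : e y ⬝ᵥ M.mulVec (e y) = ∑ j, l j * y j ^ 2 := by
      rw [hdot]
      exact Finset.sum_congr rfl fun j _ => by rw [hMe]; ring
    have h2 : ∑ j, e y j ^ 2 = ∑ j, y j ^ 2 := by
      have := hdot y (e y)
      rw [hee] at this
      simpa [dotProduct, sq] using this
    have h3 : ∑ j, ξ j * e y j = ∑ j, η j * y j := by
      have := hdot y ξ
      simpa [dotProduct, mul_comm] using this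
    simp only [gaussWeight]
    rw [h1, h2, h3, ← Real.exp_add, Complex.ofReal_exp, ← Complex.exp_add]
    congr 1
    push_cast
    rw [Finset.mul_sum, Finset.mul_sum, Finset.sum_mul, ← Finset.sum_neg_distrib,
      ← Finset.sum_neg_distrib, ← Finset.sum_add_distrib, ← Finset.sum_add_distrib,
      ← Finset.sum_add_distrib]
    exact Finset.sum_congr rfl fun j _ => by ring
  · rw [Finset.prod_mul_distrib, ← Complex.exp_sum]
    push_cast
    congr 1
    · refine Finset.prod_congr rfl fun j _ => ?_
      rw [Complex.ofReal_cpow (div_pos Real.pi_pos (hl2 j)).le]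
      push_cast
      rfl
    · congr 1
      rw [Finset.mul_sum, ← Finset.sum_neg_distrib]
      refine Finset.sum_congr rfl fun j _ => ?_
      rw [mul_pow, Complex.I_sq]
      ring

/-- The logarithm of a mixture of decaying (or growing) exponentials is convex. -/
theorem convexOn_log_integral_exp {Ω : Type*} [MeasurableSpace Ω] {ρ : Measure Ω} [NeZero ρ]
    {c d : Ω → ℝ} (hc : ∀ ω, 0 < c ω)
    (hint : ∀ r : ℝ, 0 ≤ r → Integrable (fun ω => c ω * rexp (-(r * d ω))) ρ) :
    (∀ r : ℝ, 0 ≤ r → 0 < ∫ ω, c ω * rexp (-(r * d ω)) ∂ρ) ∧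
    ConvexOn ℝ (Set.Ici 0) fun r => Real.log (∫ ω, c ω * rexp (-(r * d ω)) ∂ρ) := by
  have hpos : ∀ r : ℝ, 0 ≤ r → 0 < ∫ ω, c ω * rexp (-(r * d ω)) ∂ρ := by
    intro r hr
    rw [integral_pos_iff_support_of_nonneg
      (fun ω => (mul_pos (hc ω) (Real.exp_pos _)).le) (hint r hr)]
    have : (Function.support fun ω => c ω * rexp (-(r * d ω))) = Set.univ :=
      Set.eq_univ_of_forall fun ω => (mul_pos (hc ω) (Real.exp_pos _)).ne'
    rw [this]
    exact Measure.measure_univ_pos.2 (NeZero.ne ρ)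
  refine ⟨hpos, convex_Ici 0, fun x hx y hy a b ha hb hab => ?_⟩
  simp only [smul_eq_mul]
  have hx' : (0 : ℝ) ≤ x := hx
  have hy' : (0 : ℝ) ≤ y := hy
  have hxy : 0 ≤ a * x + b * y := by positivity
  set k : ℝ → ℝ := fun r => ∫ ω, c ω * rexp (-(r * d ω)) ∂ρ with hk
  have hkx : 0 < k x := hpos x hx
  have hky : 0 < k y := hpos y hy
  rw [← Real.log_rpow hkx, ← Real.log_rpow hky, ← Real.log_mul (by positivity) (by positivity)]
  refine Real.log_le_log (hpos _ hxy) ?_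
  have hpt : ∀ ω, c ω * rexp (-((a * x + b * y) * d ω)) ≤ k x ^ a * k y ^ b *
      (a * (c ω * rexp (-(x * d ω)) / k x) + b * (c ω * rexp (-(y * d ω)) / k y)) := by
    intro ω
    have hcω := hc ω
    have h1 := Real.geom_mean_le_arith_mean2_weighted ha hb
      (show 0 ≤ c ω * rexp (-(x * d ω)) / k x by positivity)
      (show 0 ≤ c ω * rexp (-(y * d ω)) / k y by positivity) hab
    refine le_trans (le_of_eq ?_) (mul_le_mul_of_nonneg_left h1 (by positivity))
    rw [Real.div_rpow (by positivity) hkx.le, Real.div_rpow (by positivity) hky.le,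
      Real.mul_rpow hcω.le (Real.exp_pos _).le, Real.mul_rpow hcω.le (Real.exp_pos _).le,
      ← Real.exp_mul, ← Real.exp_mul]
    have h2 : c ω = c ω ^ a * c ω ^ b := by rw [← Real.rpow_add hcω, hab, Real.rpow_one]
    have h3 : rexp (-((a * x + b * y) * d ω)) =
        rexp (-(x * d ω) * a) * rexp (-(y * d ω) * b) := by
      rw [← Real.exp_add]; ring_nf
    have h4 : k x ^ a ≠ 0 := by positivity
    have h5 : k y ^ b ≠ 0 := by positivity
    rw [h3]
    nth_rewrite 1 [h2]
    field_simp
  have hix := ((hint x hx').div_const (k x)).const_mul a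
  have hiy := ((hint y hy').div_const (k y)).const_mul b
  calc k (a * x + b * y) ≤ ∫ ω, k x ^ a * k y ^ b *
      (a * (c ω * rexp (-(x * d ω)) / k x) + b * (c ω * rexp (-(y * d ω)) / k y)) ∂ρ :=
        integral_mono (hint _ hxy) ((hix.add hiy).const_mul _) hpt
    _ = k x ^ a * k y ^ b := by
        rw [integral_const_mul, integral_add hix hiy, integral_const_mul, integral_const_mul,
          integral_div, integral_div, div_self hkx.ne', div_self hky.ne', mul_one, mul_one, hab,
          mul_one]

/-- A function `f` on `ℝ^m` is a Gaussian mixture when it is an average of functions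
`x ↦ exp (-⟨x, M x⟩)` with `M` positive semidefinite. -/
def IsGaussianMixture {m : ℕ} (f : (Fin m → ℝ) → ℝ) : Prop :=
  ∃ (Ω : Type) (_ : MeasurableSpace Ω) (ρ : Measure Ω) (M : Ω → Matrix (Fin m) (Fin m) ℝ),
    IsProbabilityMeasure ρ ∧
    Measurable (fun z : Ω × (Fin m → ℝ) => z.2 ⬝ᵥ (M z.1).mulVec z.2) ∧
    (∀ ω, (M ω).PosSemidef) ∧ ∀ x, f x = ∫ ω, rexp (-(x ⬝ᵥ (M ω).mulVec x)) ∂ρ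

theorem IsGaussianMixture.fourier {m : ℕ} {f : (Fin m → ℝ) → ℝ} (hf : IsGaussianMixture f)
    (ξ : Fin m → ℝ) :
    ∃ k : ℝ → ℝ, (∀ r, 0 ≤ r → 0 < k r) ∧ ConvexOn ℝ (Set.Ici 0) (fun r => Real.log (k r)) ∧
      ∀ s : ℝ, ∫ x : Fin m → ℝ, ((f x * gaussWeight x : ℝ) : ℂ) *
        Complex.exp ((s * ∑ j, ξ j * x j : ℝ) * Complex.I) = (k (s ^ 2) : ℂ) := by
  obtain ⟨Ω, _, ρ, M, _, hmeas, hM, hfx⟩ := hf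
  choose c hc d hd using fun ω => (hM ω).integral_exp_neg_mul_cexp ξ
  have hjoint : ∀ s : ℝ, Integrable (fun z : Ω × (Fin m → ℝ) =>
      ((rexp (-(z.2 ⬝ᵥ (M z.1).mulVec z.2)) * gaussWeight z.2 : ℝ) : ℂ) *
        Complex.exp ((s * ∑ j, ξ j * z.2 j : ℝ) * Complex.I)) (ρ.prod volume) := by
    intro s
    have hg : Integrable (fun z : Ω × (Fin m → ℝ) => gaussWeight z.2) (ρ.prod volume) :=
      integrable_gaussWeight.comp_snd ρ
    refine hg.mono ?_ (Eventually.of_forall fun z => ?_)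
    · refine Measurable.aestronglyMeasurable ?_
      have h1 : Measurable fun z : Ω × (Fin m → ℝ) => gaussWeight z.2 := by fun_prop
      have h2 := hmeas.neg.exp
      fun_prop
    · rw [norm_mul, Complex.norm_exp_ofReal_mul_I, mul_one, Complex.norm_real, norm_mul,
        Real.norm_of_nonneg (Real.exp_pos _).le]
      refine mul_le_of_le_one_left (norm_nonneg _) (Real.exp_le_one_iff.2 ?_)
      simpa using (hM z.1).dotProduct_mulVec_nonneg z.2
  have hint : ∀ r : ℝ, 0 ≤ r → Integrable (fun ω => c ω * rexp (-(r * d ω))) ρ := by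
    intro r hr
    have h := (hjoint (√r)).integral_prod_left
    simp only [hd, Real.sq_sqrt hr] at h
    simpa only [RCLike.re_to_complex, Complex.ofReal_re] using h.re
  obtain ⟨hpos, hconv⟩ := convexOn_log_integral_exp hc hint
  refine ⟨_, hpos, hconv, fun s => ?_⟩
  rw [← integral_complex_ofReal]
  simp only [← hd]
  rw [integral_integral_swap (hjoint s)]
  refine integral_congr_ae (Eventually.of_forall fun x => ?_)
  simp only
  rw [integral_mul_const, hfx, integral_complex_ofReal, integral_mul_const]

theorem IsGaussianMixture.measurable {m : ℕ} {f : (Fin m → ℝ) → ℝ} (hf : IsGaussianMixture f) :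
    Measurable f := by
  obtain ⟨Ω, _, ρ, M, _, hmeas, hM, hfx⟩ := hf
  rw [funext hfx]
  exact (StronglyMeasurable.integral_prod_left' (f := fun z : Ω × (Fin m → ℝ) =>
    rexp (-(z.2 ⬝ᵥ (M z.1).mulVec z.2))) hmeas.neg.exp.stronglyMeasurable).measurable

theorem IsGaussianMixture.mem_Icc {m : ℕ} {f : (Fin m → ℝ) → ℝ} (hf : IsGaussianMixture f)
    (x : Fin m → ℝ) : f x ∈ Set.Icc 0 1 := by
  obtain ⟨Ω, _, ρ, M, _, hmeas, hM, hfx⟩ := hf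
  rw [hfx]
  refine ⟨integral_nonneg fun ω => (Real.exp_pos _).le, ?_⟩
  have h : ∀ ω, rexp (-(x ⬝ᵥ (M ω).mulVec x)) ≤ 1 := fun ω => by
    rw [Real.exp_le_one_iff]
    simpa using (hM ω).dotProduct_mulVec_nonneg x
  calc _ ≤ ∫ _, (1 : ℝ) ∂ρ := integral_mono_of_nonneg
        (Eventually.of_forall fun ω => (Real.exp_pos _).le) (integrable_const _)
        (Eventually.of_forall h)
    _ = 1 := by simp

/-- `∫ ∏ f(x_i) exp (-|x|² / 2 - β |∑ θ_i x_i|² / 2) dx` over `(ℝ^m)^n`. -/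
def penalizedIntegral {m n : ℕ} (β : ℝ) (θ : Fin n → ℝ) (f : (Fin m → ℝ) → ℝ) : ℝ :=
  ∫ x : Fin n → Fin m → ℝ, (∏ i, f (x i) * gaussWeight (x i)) *
    gaussWeight (fun j => √β * ∑ i, θ i * x i j)

theorem integrable_mul_gaussWeight {m : ℕ} {f : (Fin m → ℝ) → ℝ} (hf : Measurable f)
    (hf1 : ∀ x, f x ∈ Set.Icc 0 1) : Integrable fun x => f x * gaussWeight x := by
  refine integrable_gaussWeight.mono (hf.mul measurable_gaussWeight).aestronglyMeasurable
    (Eventually.of_forall fun x => ?_)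
  rw [norm_mul, Real.norm_of_nonneg (hf1 x).1]
  exact mul_le_of_le_one_left (norm_nonneg _) (hf1 x).2

theorem integrable_penalizedIntegral_fourier {m n : ℕ} {f : (Fin m → ℝ) → ℝ}
    (hf : Measurable f) (hf1 : ∀ x, f x ∈ Set.Icc 0 1) (β : ℝ) (θ : Fin n → ℝ) : Integrable
    (fun z : (Fin n → Fin m → ℝ) × (Fin m → ℝ) => (gaussWeight z.2 : ℂ) *
      ∏ i, ((f (z.1 i) * gaussWeight (z.1 i) : ℝ) : ℂ) *
        Complex.exp (((√β * θ i) * ∑ j, z.2 j * z.1 i j : ℝ) * Complex.I)) := by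
  have h1 : Integrable fun x : Fin n → Fin m → ℝ => ∏ i, (f (x i) * gaussWeight (x i)) :=
    Integrable.fintype_prod (f := fun _ y => f y * gaussWeight y)
      fun _ => integrable_mul_gaussWeight hf hf1
  have h2 := h1.mul_prod (integrable_gaussWeight (ι := Fin m))
  refine h2.mono (Measurable.aestronglyMeasurable (by fun_prop)) (Eventually.of_forall fun z => ?_)
  refine le_of_eq ?_
  rw [norm_mul, norm_mul, norm_prod, norm_prod, Complex.norm_real, mul_comm]
  congr 1
  refine Finset.prod_congr rfl fun i _ => ?_
  rw [norm_mul, Complex.norm_exp_ofReal_mul_I, mul_one, Complex.norm_real]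

theorem penalizedIntegral_eq_fourier {m n : ℕ} {f : (Fin m → ℝ) → ℝ}
    (hf : Measurable f) (hf1 : ∀ x, f x ∈ Set.Icc 0 1) (β : ℝ) (θ : Fin n → ℝ) :
    (((2 * π) ^ ((m : ℝ) / 2) * penalizedIntegral β θ f : ℝ) : ℂ) =
      ∫ η : Fin m → ℝ, (gaussWeight η : ℂ) * ∏ i, ∫ x : Fin m → ℝ,
        ((f x * gaussWeight x : ℝ) : ℂ) *
          Complex.exp (((√β * θ i) * ∑ j, η j * x j : ℝ) * Complex.I) := by
  have hprod : ∀ η : Fin m → ℝ, (∏ i, ∫ x : Fin m → ℝ, ((f x * gaussWeight x : ℝ) : ℂ) *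
      Complex.exp (((√β * θ i) * ∑ j, η j * x j : ℝ) * Complex.I)) =
      ∫ x : Fin n → Fin m → ℝ, ∏ i, ((f (x i) * gaussWeight (x i) : ℝ) : ℂ) *
        Complex.exp (((√β * θ i) * ∑ j, η j * x i j : ℝ) * Complex.I) := fun η =>
    (integral_fintype_prod_volume_eq_prod (fun i (x : Fin m → ℝ) =>
      ((f x * gaussWeight x : ℝ) : ℂ) *
        Complex.exp (((√β * θ i) * ∑ j, η j * x j : ℝ) * Complex.I))).symm
  simp only [hprod, ← integral_const_mul]
  rw [← integral_integral_swap (f := fun (x : Fin n → Fin m → ℝ) (η : Fin m → ℝ) =>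
    (gaussWeight η : ℂ) * ∏ i, ((f (x i) * gaussWeight (x i) : ℝ) : ℂ) *
        Complex.exp (((√β * θ i) * ∑ j, η j * x i j : ℝ) * Complex.I))
    (integrable_penalizedIntegral_fourier hf hf1 β θ)]
  rw [penalizedIntegral, ← integral_const_mul, ← integral_complex_ofReal]
  refine integral_congr_ae (Eventually.of_forall fun x => ?_)
  simp only
  have h := integral_gaussWeight_mul_cexp fun j => √β * ∑ i, θ i * x i j
  rw [Fintype.card_fin] at h
  rw [mul_left_comm, Complex.ofReal_mul, ← h, ← integral_const_mul]
  refine integral_congr_ae (Eventually.of_forall fun η => ?_)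
  simp only
  rw [Complex.ofReal_prod, mul_left_comm]
  congr 1
  rw [Finset.prod_mul_distrib, ← Complex.exp_sum, ← Finset.sum_mul, ← Complex.ofReal_sum]
  congr 4
  simp only [Finset.mul_sum, Finset.sum_mul]
  rw [Finset.sum_comm]
  exact Finset.sum_congr rfl fun i _ => Finset.sum_congr rfl fun j _ => by ring

theorem IsGaussianMixture.penalizedIntegral_le {m n : ℕ} {f : (Fin m → ℝ) → ℝ}
    (hf : IsGaussianMixture f) {β : ℝ} (hβ : 0 ≤ β) {θ φ : Fin n → ℝ}
    (hmaj : IsMajorizedBy (fun i => θ i ^ 2) (fun i => φ i ^ 2)) :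
    penalizedIntegral β θ f ≤ penalizedIntegral β φ f := by
  choose k hkpos hkconv hk using hf.fourier
  have key : ∀ θ : Fin n → ℝ,
      Integrable (fun η : Fin m → ℝ => gaussWeight η * ∏ i, k η (β * θ i ^ 2)) ∧
      (2 * π) ^ ((m : ℝ) / 2) * penalizedIntegral β θ f =
        ∫ η : Fin m → ℝ, gaussWeight η * ∏ i, k η (β * θ i ^ 2) := by
    intro θ
    have hk' : ∀ (η : Fin m → ℝ) (i : Fin n), ∫ x : Fin m → ℝ, ((f x * gaussWeight x : ℝ) : ℂ) *
        Complex.exp (((√β * θ i) * ∑ j, η j * x j : ℝ) * Complex.I) = k η (β * θ i ^ 2) := by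
      intro η i
      rw [hk, mul_pow, Real.sq_sqrt hβ]
    have h1 := penalizedIntegral_eq_fourier hf.measurable hf.mem_Icc β θ
    have h2 := (integrable_penalizedIntegral_fourier hf.measurable hf.mem_Icc β θ).integral_prod_right
    constructor
    · simp only [integral_const_mul] at h2
      have h3 : ∀ η : Fin m → ℝ, ∫ x : Fin n → Fin m → ℝ,
          ∏ i, ((f (x i) * gaussWeight (x i) : ℝ) : ℂ) *
          Complex.exp (((√β * θ i) * ∑ j, η j * x i j : ℝ) * Complex.I) =
          ((∏ i, k η (β * θ i ^ 2) : ℝ) : ℂ) := by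
        intro η
        rw [integral_fintype_prod_volume_eq_prod (fun i (x : Fin m → ℝ) =>
          ((f x * gaussWeight x : ℝ) : ℂ) *
          Complex.exp (((√β * θ i) * ∑ j, η j * x j : ℝ) * Complex.I)), Complex.ofReal_prod]
        exact Finset.prod_congr rfl fun i _ => hk' η i
      simp only [h3, ← Complex.ofReal_mul] at h2
      simpa only [RCLike.re_to_complex, Complex.ofReal_re] using h2.re
    · simp only [hk', ← Complex.ofReal_prod, ← Complex.ofReal_mul] at h1
      rw [integral_complex_ofReal] at h1
      exact_mod_cast h1
  have hC : 0 < (2 * π) ^ ((m : ℝ) / 2) := by positivity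
  refine le_of_mul_le_mul_left ?_ hC
  rw [(key θ).2, (key φ).2]
  refine integral_mono (key θ).1 (key φ).1 fun η => ?_
  refine mul_le_mul_of_nonneg_left ?_ (gaussWeight_pos η).le
  have hp : ∀ (θ : Fin n → ℝ) i, 0 < k η (β * θ i ^ 2) := fun θ i => hkpos η _ (by positivity)
  rw [← Real.log_le_log_iff (Finset.prod_pos fun i _ => hp θ i)
    (Finset.prod_pos fun i _ => hp φ i), Real.log_prod (fun i _ => (hp θ i).ne'),
    Real.log_prod (fun i _ => (hp φ i).ne')]
  have hmaj' : IsMajorizedBy (fun i => β * θ i ^ 2) (fun i => β * φ i ^ 2) := by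
    refine ⟨fun A => ?_, by rw [← Finset.mul_sum, ← Finset.mul_sum, hmaj.2]⟩
    obtain ⟨B, hB, hle⟩ := hmaj.1 A
    refine ⟨B, hB, ?_⟩
    rw [← Finset.mul_sum, ← Finset.mul_sum]
    exact mul_le_mul_of_nonneg_left hle hβ
  exact hmaj'.sum_le_sum_of_convexOn (hkconv η)
    (fun i => Set.mem_Ici.2 (by positivity)) fun i => Set.mem_Ici.2 (by positivity)

theorem penalizedIntegral_one {m n : ℕ} {β : ℝ} (hβ : 0 ≤ β) {θ : Fin n → ℝ}
    (hθ : ∑ i, θ i ^ 2 = 1) :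
    (2 * π) ^ ((m : ℝ) / 2) * penalizedIntegral β θ (fun _ : Fin m → ℝ => 1) =
      ((2 * π) ^ ((m : ℝ) / 2)) ^ n *
        ∫ η : Fin m → ℝ, gaussWeight η * rexp (-(β / 2) * ∑ j, η j ^ 2) := by
  have h := penalizedIntegral_eq_fourier (f := fun _ : Fin m → ℝ => 1) measurable_const
    (fun _ => by simp) β θ
  have h1 : ∀ (η : Fin m → ℝ) (i : Fin n), ∫ x : Fin m → ℝ, ((1 * gaussWeight x : ℝ) : ℂ) *
        Complex.exp (((√β * θ i) * ∑ j, η j * x j : ℝ) * Complex.I) =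
        (((2 * π) ^ ((m : ℝ) / 2) * rexp (-(β / 2) * (∑ j, η j ^ 2) * θ i ^ 2) : ℝ) : ℂ) := by
    intro η i
    have := integral_gaussWeight_mul_cexp fun j => (√β * θ i) * η j
    rw [Fintype.card_fin] at this
    simp only [one_mul, Finset.mul_sum, ← mul_assoc] at this ⊢
    rw [this]
    simp only [gaussWeight, mul_pow, Real.sq_sqrt hβ]
    congr 3
    rw [Finset.mul_sum, Finset.sum_mul]
    exact Finset.sum_congr rfl fun j _ => by ring
  simp only [h1, ← Complex.ofReal_prod, ← Complex.ofReal_mul] at h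
  rw [integral_complex_ofReal] at h
  rw [Complex.ofReal_inj.1 h, ← integral_const_mul]
  refine integral_congr_ae (Eventually.of_forall fun η => ?_)
  simp only [Finset.prod_mul_distrib, Finset.prod_const, Finset.card_univ, Fintype.card_fin]
  rw [← Real.exp_sum, ← Finset.mul_sum, hθ, mul_one]
  ring

/-- The map `x ↦ x - τ Q x` on `(ℝ^m)^n`, where `(Q x)_i = θ_i ∑ θ_k x_k`; for a unit vector `θ`
and `τ = 1` it is the orthogonal projection onto `∑ θ_i x_i = 0`. -/
def shrinkMap {m n : ℕ} (τ : ℝ) (θ : Fin n → ℝ) :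
    (Fin n → Fin m → ℝ) →ₗ[ℝ] (Fin n → Fin m → ℝ) where
  toFun x i j := x i j - τ * (θ i * ∑ k, θ k * x k j)
  map_add' x y := by
    ext i j
    simp only [Pi.add_apply, mul_add, Finset.sum_add_distrib]
    ring
  map_smul' c x := by
    ext i j
    simp only [Pi.smul_apply, smul_eq_mul, RingHom.id_apply, mul_left_comm _ c,
      ← Finset.mul_sum]
    ring

theorem shrinkMap_apply {m n : ℕ} (τ : ℝ) (θ : Fin n → ℝ) (x : Fin n → Fin m → ℝ) (i : Fin n)
    (j : Fin m) : shrinkMap τ θ x i j = x i j - τ * (θ i * ∑ k, θ k * x k j) := rfl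

theorem sum_mul_shrinkMap {m n : ℕ} (τ : ℝ) {θ : Fin n → ℝ} (hθ : ∑ i, θ i ^ 2 = 1)
    (x : Fin n → Fin m → ℝ) (j : Fin m) :
    ∑ i, θ i * shrinkMap τ θ x i j = (1 - τ) * ∑ i, θ i * x i j := by
  have h : ∀ i, θ i * shrinkMap τ θ x i j =
      θ i * x i j - θ i ^ 2 * (τ * ∑ k, θ k * x k j) := fun i => by
    rw [shrinkMap_apply]; ring
  rw [Finset.sum_congr rfl fun i _ => h i, Finset.sum_sub_distrib, ← Finset.sum_mul, hθ]
  ring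

theorem sum_sq_shrinkMap {m n : ℕ} (τ : ℝ) {θ : Fin n → ℝ} (hθ : ∑ i, θ i ^ 2 = 1)
    (x : Fin n → Fin m → ℝ) (j : Fin m) :
    ∑ i, shrinkMap τ θ x i j ^ 2 =
      ∑ i, x i j ^ 2 - (1 - (1 - τ) ^ 2) * (∑ i, θ i * x i j) ^ 2 := by
  have h : ∀ i, shrinkMap τ θ x i j ^ 2 =
      x i j ^ 2 - (θ i * x i j) * (2 * τ * ∑ k, θ k * x k j) +
        θ i ^ 2 * (τ * ∑ k, θ k * x k j) ^ 2 := fun i => by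
    rw [shrinkMap_apply]; ring
  rw [Finset.sum_congr rfl fun i _ => h i, Finset.sum_add_distrib, Finset.sum_sub_distrib,
    ← Finset.sum_mul, ← Finset.sum_mul, hθ]
  ring

theorem det_shrinkMap_ne_zero {m n : ℕ} {τ : ℝ} (hτ : τ < 1) {θ : Fin n → ℝ}
    (hθ : ∑ i, θ i ^ 2 = 1) :
    LinearMap.det (shrinkMap τ θ : (Fin n → Fin m → ℝ) →ₗ[ℝ] (Fin n → Fin m → ℝ)) ≠ 0 := by
  have hcomp : (shrinkMap (-τ / (1 - τ)) θ).comp (shrinkMap τ θ) =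
      (LinearMap.id : (Fin n → Fin m → ℝ) →ₗ[ℝ] (Fin n → Fin m → ℝ)) := by
    refine LinearMap.ext fun x => funext fun i => funext fun j => ?_
    rw [LinearMap.comp_apply, shrinkMap_apply, sum_mul_shrinkMap τ hθ, shrinkMap_apply,
      LinearMap.id_apply]
    have : 1 - τ ≠ 0 := by linarith
    field_simp
    ring
  intro h0
  have := congrArg LinearMap.det hcomp
  rw [LinearMap.det_comp, h0, mul_zero, LinearMap.det_id] at this
  exact zero_ne_one this

theorem exists_integral_shrinkMap_eq {m n : ℕ} {τ : ℝ} (hτ : τ < 1) {θ : Fin n → ℝ}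
    (hθ : ∑ i, θ i ^ 2 = 1) (hβ : 0 ≤ (1 - τ)⁻¹ ^ 2 - 1) :
    ∃ C : ℝ, 0 ≤ C ∧ ∀ f : (Fin m → ℝ) → ℝ, Measurable f →
      ∫ x : Fin n → Fin m → ℝ, (∏ i, f (shrinkMap τ θ x i)) * ∏ i, gaussWeight (x i) =
        C * penalizedIntegral ((1 - τ)⁻¹ ^ 2 - 1) θ f := by
  set A : (Fin n → Fin m → ℝ) →ₗ[ℝ] (Fin n → Fin m → ℝ) := shrinkMap τ θ with hA
  have hdet := det_shrinkMap_ne_zero (m := m) hτ hθ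
  have hτ' : 1 - τ ≠ 0 := by linarith
  refine ⟨|(LinearMap.det A)⁻¹|, abs_nonneg _, fun f hf => ?_⟩
  have hweight : ∀ x : Fin n → Fin m → ℝ, ∏ i, gaussWeight (x i) =
      (∏ i, gaussWeight (A x i)) *
        gaussWeight (fun j => √((1 - τ)⁻¹ ^ 2 - 1) * ∑ i, θ i * A x i j) := by
    intro x
    simp only [gaussWeight, ← Real.exp_sum, ← Real.exp_add, ← Finset.mul_sum, ← mul_add]
    rw [Finset.sum_comm, Finset.sum_comm (f := fun i j => A x i j ^ 2), ← Finset.sum_add_distrib]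
    congr 2
    refine Finset.sum_congr rfl fun j _ => ?_
    rw [hA, sum_mul_shrinkMap τ hθ, sum_sq_shrinkMap τ hθ, mul_pow, Real.sq_sqrt hβ]
    field_simp
    ring
  have hAm : Measurable A := A.continuous_of_finiteDimensional.measurable
  have hmap := Measure.map_linearMap_addHaar_eq_smul_addHaar
    (volume : Measure (Fin n → Fin m → ℝ)) hdet
  have hG : Measurable fun x : Fin n → Fin m → ℝ => (∏ i, f (x i) * gaussWeight (x i)) *
    gaussWeight (fun j => √((1 - τ)⁻¹ ^ 2 - 1) * ∑ i, θ i * x i j) := by fun_prop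
  have h := integral_map (μ := volume) hAm.aemeasurable hG.aestronglyMeasurable
  rw [hmap, integral_smul_measure, ENNReal.toReal_ofReal (abs_nonneg _), smul_eq_mul] at h
  rw [penalizedIntegral, h]
  refine integral_congr_ae (Eventually.of_forall fun x => ?_)
  simp only
  rw [hweight x, Finset.prod_mul_distrib]
  ring

theorem integral_prod_gaussWeight_pos (m n : ℕ) :
    0 < ∫ x : Fin n → Fin m → ℝ, ∏ i, gaussWeight (x i) := by
  rw [integral_fintype_prod_volume_eq_prod (fun _ => gaussWeight)]
  refine Finset.prod_pos fun i _ => ?_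
  exact integral_pos_of_integrable_nonneg_nonzero continuous_gaussWeight integrable_gaussWeight
    (fun x => (gaussWeight_pos x).le) (gaussWeight_pos 0).ne'

theorem IsGaussianMixture.integral_shrinkMap_le {m n : ℕ} {f : (Fin m → ℝ) → ℝ}
    (hf : IsGaussianMixture f) {τ : ℝ} (hτ0 : 0 ≤ τ) (hτ : τ < 1) {θ φ : Fin n → ℝ}
    (hθ : ∑ i, θ i ^ 2 = 1) (hφ : ∑ i, φ i ^ 2 = 1)
    (hmaj : IsMajorizedBy (fun i => θ i ^ 2) (fun i => φ i ^ 2)) :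
    ∫ x : Fin n → Fin m → ℝ, (∏ i, f (shrinkMap τ θ x i)) * ∏ i, gaussWeight (x i) ≤
      ∫ x : Fin n → Fin m → ℝ, (∏ i, f (shrinkMap τ φ x i)) * ∏ i, gaussWeight (x i) := by
  have hβ : 0 ≤ (1 - τ)⁻¹ ^ 2 - 1 :=
    sub_nonneg.2 (one_le_pow₀ ((one_le_inv₀ (by linarith)).2 (by linarith)))
  obtain ⟨C, hC, hCf⟩ := exists_integral_shrinkMap_eq (m := m) hτ hθ hβ
  obtain ⟨D, hD, hDf⟩ := exists_integral_shrinkMap_eq (m := m) hτ hφ hβ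
  have hpen : penalizedIntegral ((1 - τ)⁻¹ ^ 2 - 1) θ (fun _ : Fin m → ℝ => 1) =
      penalizedIntegral ((1 - τ)⁻¹ ^ 2 - 1) φ (fun _ : Fin m → ℝ => 1) := by
    have h0 : (2 * π) ^ ((m : ℝ) / 2) ≠ 0 := by positivity
    exact mul_left_cancel₀ h0
      ((penalizedIntegral_one hβ hθ).trans (penalizedIntegral_one hβ hφ).symm)
  have h1 := hCf (fun _ => 1) measurable_const
  have h2 := hDf (fun _ => 1) measurable_const
  have hpos := integral_prod_gaussWeight_pos m n
  simp only [Finset.prod_const_one, one_mul] at h1 h2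
  have hCD : C = D := by
    rw [← hpen, h1] at h2
    refine mul_right_cancel₀ (fun h => ?_) h2
    rw [h1, h, mul_zero] at hpos
    exact lt_irrefl _ hpos
  rw [hCf f hf.measurable, hDf f hf.measurable, ← hCD]
  exact mul_le_mul_of_nonneg_left (hf.penalizedIntegral_le hβ hmaj) hC

/-- `f` takes values in `[0, 1]` and satisfies the comparison inequality between `θ` and `φ` for
all the contractions `shrinkMap τ`, `0 ≤ τ < 1`. -/
def IsShrinkMonotone {m n : ℕ} (θ φ : Fin n → ℝ) (f : (Fin m → ℝ) → ℝ) : Prop :=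
  Measurable f ∧ (∀ x, f x ∈ Set.Icc 0 1) ∧ ∀ τ : ℝ, 0 ≤ τ → τ < 1 →
    ∫ x : Fin n → Fin m → ℝ, (∏ i, f (shrinkMap τ θ x i)) * ∏ i, gaussWeight (x i) ≤
      ∫ x : Fin n → Fin m → ℝ, (∏ i, f (shrinkMap τ φ x i)) * ∏ i, gaussWeight (x i)

theorem integrable_prod_gaussWeight (m n : ℕ) :
    Integrable fun x : Fin n → Fin m → ℝ => ∏ i, gaussWeight (x i) :=
  Integrable.fintype_prod (f := fun _ y => gaussWeight y) fun _ => integrable_gaussWeight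

theorem measurable_shrinkMap {m n : ℕ} (τ : ℝ) (θ : Fin n → ℝ) :
    Measurable (shrinkMap τ θ : (Fin n → Fin m → ℝ) →ₗ[ℝ] (Fin n → Fin m → ℝ)) :=
  (shrinkMap τ θ).continuous_of_finiteDimensional.measurable

theorem tendsto_integral_prod_mul_gaussWeight {m n : ℕ}
    {F : ℕ → (Fin n → Fin m → ℝ) → Fin n → ℝ} {f : (Fin n → Fin m → ℝ) → Fin n → ℝ}
    (hF : ∀ k i, Measurable fun x => F k x i) (hF1 : ∀ k x i, F k x i ∈ Set.Icc 0 1)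
    (hlim : ∀ x i, Tendsto (fun k => F k x i) atTop (nhds (f x i))) :
    Tendsto (fun k => ∫ x, (∏ i, F k x i) * ∏ i, gaussWeight (x i)) atTop
      (nhds (∫ x, (∏ i, f x i) * ∏ i, gaussWeight (x i))) := by
  refine tendsto_integral_of_dominated_convergence (fun x => ∏ i, gaussWeight (x i))
    (fun k => Measurable.aestronglyMeasurable ?_) (integrable_prod_gaussWeight m n)
    (fun k => Eventually.of_forall fun x => ?_) (Eventually.of_forall fun x => ?_)
  · exact (Finset.measurable_prod _ fun i _ => hF k i).mul (by fun_prop)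
  · have h0 : 0 ≤ ∏ i, gaussWeight (x i) := Finset.prod_nonneg fun i _ => (gaussWeight_pos _).le
    rw [norm_mul, Real.norm_of_nonneg h0,
      Real.norm_of_nonneg (Finset.prod_nonneg fun i _ => (hF1 k x i).1)]
    exact mul_le_of_le_one_left h0
      (Finset.prod_le_one (fun i _ => (hF1 k x i).1) fun i _ => (hF1 k x i).2)
  · exact (tendsto_finsetProd _ fun i _ => hlim x i).mul_const _

theorem IsShrinkMonotone.of_tendsto {m n : ℕ} {θ φ : Fin n → ℝ}
    {F : ℕ → (Fin m → ℝ) → ℝ} {f : (Fin m → ℝ) → ℝ} (hF : ∀ k, IsShrinkMonotone θ φ (F k))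
    (hlim : ∀ x, Tendsto (fun k => F k x) atTop (nhds (f x))) : IsShrinkMonotone θ φ f := by
  refine ⟨measurable_of_tendsto_metrizable (fun k => (hF k).1) (tendsto_pi_nhds.2 hlim),
    fun x => isClosed_Icc.mem_of_tendsto (hlim x) (Eventually.of_forall fun k => (hF k).2.1 x),
    fun τ hτ0 hτ => ?_⟩
  have h : ∀ θ : Fin n → ℝ, Tendsto (fun k => ∫ x : Fin n → Fin m → ℝ,
      (∏ i, F k (shrinkMap τ θ x i)) * ∏ i, gaussWeight (x i)) atTop
      (nhds (∫ x : Fin n → Fin m → ℝ,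
        (∏ i, f (shrinkMap τ θ x i)) * ∏ i, gaussWeight (x i))) := fun θ =>
    tendsto_integral_prod_mul_gaussWeight (F := fun k x i => F k (shrinkMap τ θ x i))
      (fun k i => (hF k).1.comp ((measurable_pi_apply i).comp (measurable_shrinkMap τ θ)))
      (fun k x i => (hF k).2.1 _) fun x i => hlim _
  exact le_of_tendsto_of_tendsto' (h θ) (h φ) fun k => (hF k).2.2 τ hτ0 hτ

theorem isGaussianMixture_pow_integral {m : ℕ} {Ω : Type} [MeasurableSpace Ω] (ρ : Measure Ω)
    [IsProbabilityMeasure ρ] {t : Ω → ℝ} (ht : Measurable t) (ht0 : ∀ ω, 0 ≤ t ω)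
    {v : Ω → Fin m → ℝ} (hv : Measurable v) (K : ℕ) :
    IsGaussianMixture fun x : Fin m → ℝ =>
      (∫ ω, rexp (-(t ω * (∑ j, x j * v ω j) ^ 2)) ∂ρ) ^ K := by
  have hquad : ∀ (ω : Fin K → Ω) (x : Fin m → ℝ),
      x ⬝ᵥ (∑ k, t (ω k) • Matrix.vecMulVec (v (ω k)) (v (ω k))).mulVec x =
        ∑ k, t (ω k) * (∑ j, x j * v (ω k) j) ^ 2 := by
    intro ω x
    rw [Matrix.sum_mulVec, dotProduct_sum]
    refine Finset.sum_congr rfl fun k _ => ?_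
    rw [Matrix.smul_mulVec, dotProduct_smul, Matrix.vecMulVec_mulVec, dotProduct_smul,
      dotProduct_comm (v (ω k)) x, smul_eq_mul, sq]
    rfl
  refine ⟨Fin K → Ω, inferInstance, Measure.pi fun _ => ρ,
    fun ω => ∑ k, t (ω k) • Matrix.vecMulVec (v (ω k)) (v (ω k)), inferInstance, ?_, ?_, ?_⟩
  · simp only [hquad]
    have hv' : ∀ j k, Measurable fun z : (Fin K → Ω) × (Fin m → ℝ) => v (z.1 k) j := fun j k =>
      (measurable_pi_apply j).comp (hv.comp ((measurable_pi_apply k).comp measurable_fst))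
    fun_prop
  · intro ω
    refine Matrix.posSemidef_sum _ fun k _ => Matrix.PosSemidef.smul ?_ (ht0 _)
    simpa using Matrix.posSemidef_vecMulVec_self_star (v (ω k))
  · intro x
    simp only [hquad]
    have h := integral_fintype_prod_eq_pow (μ := ρ) (ι := Fin K)
      (fun ω => rexp (-(t ω * (∑ j, x j * v ω j) ^ 2)))
    rw [Fintype.card_fin] at h
    rw [← h]
    refine integral_congr_ae (Eventually.of_forall fun ω => ?_)
    simp only
    rw [← Real.exp_sum, Finset.sum_neg_distrib]

theorem isShrinkMonotone_exp_neg_integral {m n : ℕ} {θ φ : Fin n → ℝ}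
    (hθ : ∑ i, θ i ^ 2 = 1) (hφ : ∑ i, φ i ^ 2 = 1)
    (hmaj : IsMajorizedBy (fun i => θ i ^ 2) (fun i => φ i ^ 2))
    {Ω : Type} [MeasurableSpace Ω] (ρ : Measure Ω)
    [IsFiniteMeasure ρ] {t : Ω → ℝ} (ht : Measurable t) (ht0 : ∀ ω, 0 ≤ t ω)
    {v : Ω → Fin m → ℝ} (hv : Measurable v) {ω₀ : Ω} (hω₀ : t ω₀ = 0) :
    IsShrinkMonotone θ φ fun x : Fin m → ℝ =>
      rexp (-∫ ω, (1 - rexp (-(t ω * (∑ j, x j * v ω j) ^ 2))) ∂ρ) := by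
  set M : ℕ := ⌈ρ.real Set.univ⌉₊ + 1 with hM
  have hMρ : ∀ k : ℕ, ρ.real Set.univ ≤ (k + M : ℕ) := fun k =>
    (Nat.le_ceil _).trans (by exact_mod_cast (by omega))
  have hK0 : ∀ k : ℕ, 0 < ((k + M : ℕ) : ℝ) := fun k => by
    exact_mod_cast (by omega : 0 < k + M)
  have hmeas : ∀ x : Fin m → ℝ,
      Measurable fun ω => rexp (-(t ω * (∑ j, x j * v ω j) ^ 2)) := fun x => by fun_prop
  have hle : ∀ (x : Fin m → ℝ) ω, rexp (-(t ω * (∑ j, x j * v ω j) ^ 2)) ≤ 1 := fun x ω =>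
    Real.exp_le_one_iff.2 (neg_nonpos.2 (mul_nonneg (ht0 ω) (sq_nonneg _)))
  have hint : ∀ (κ : Measure Ω) [IsFiniteMeasure κ] (x : Fin m → ℝ),
      Integrable (fun ω => rexp (-(t ω * (∑ j, x j * v ω j) ^ 2))) κ := fun κ _ x =>
    Integrable.of_bound (hmeas x).aestronglyMeasurable 1 (Eventually.of_forall fun ω => by
      rw [Real.norm_of_nonneg (Real.exp_pos _).le]; exact hle x ω)
  let κ : ℕ → Measure Ω := fun k => ENNReal.ofReal (1 / (k + M : ℕ)) • ρ +
    ENNReal.ofReal (1 - ρ.real Set.univ / (k + M : ℕ)) • Measure.dirac ω₀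
  have hsub : ∀ k : ℕ, 0 ≤ 1 - ρ.real Set.univ / (k + M : ℕ) := fun k =>
    sub_nonneg.2 ((div_le_one (hK0 k)).2 (hMρ k))
  have hκ : ∀ k, IsProbabilityMeasure (κ k) := by
    intro k
    constructor
    simp only [κ, Measure.coe_add, Pi.add_apply, Measure.smul_apply, smul_eq_mul, measure_univ,
      mul_one]
    rw [← ofReal_measureReal (measure_ne_top ρ _), ← ENNReal.ofReal_mul (by positivity),
      ← ENNReal.ofReal_add (by positivity) (hsub k)]
    rw [← ENNReal.ofReal_one]
    congr 1
    ring
  have hκint : ∀ k (x : Fin m → ℝ), ∫ ω, rexp (-(t ω * (∑ j, x j * v ω j) ^ 2)) ∂κ k =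
      1 + (-∫ ω, (1 - rexp (-(t ω * (∑ j, x j * v ω j) ^ 2))) ∂ρ) / (k + M : ℕ) := by
    intro k x
    rw [integral_add_measure ((hint ρ x).smul_measure ENNReal.ofReal_ne_top)
      ((hint _ x).smul_measure ENNReal.ofReal_ne_top), integral_smul_measure,
      integral_smul_measure, integral_dirac' _ _ (hmeas x).stronglyMeasurable, hω₀,
      ENNReal.toReal_ofReal (by positivity), ENNReal.toReal_ofReal (hsub k),
      integral_sub (integrable_const 1) (hint ρ x), integral_const]
    simp only [smul_eq_mul, zero_mul, neg_zero, Real.exp_zero]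
    ring
  refine IsShrinkMonotone.of_tendsto (F := fun k x =>
    (∫ ω, rexp (-(t ω * (∑ j, x j * v ω j) ^ 2)) ∂κ k) ^ (k + M)) (fun k => ?_) fun x => ?_
  · have := isGaussianMixture_pow_integral (κ k) ht ht0 hv (k + M)
    exact ⟨this.measurable, this.mem_Icc, fun τ h0 h1 =>
      this.integral_shrinkMap_le h0 h1 hθ hφ hmaj⟩
  · simp only [hκint]
    exact (Real.tendsto_one_add_div_pow_exp _).comp (tendsto_add_atTop_nat M)

/-- The (unnormalized) standard Gaussian measure on `(ℝ^m)^n`. -/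
def gaussMeasure (m n : ℕ) : Measure (Fin n → Fin m → ℝ) :=
  volume.withDensity fun x => ENNReal.ofReal (∏ i, gaussWeight (x i))

theorem prod_gaussWeight_nonneg {m n : ℕ} (x : Fin n → Fin m → ℝ) : 0 ≤ ∏ i, gaussWeight (x i) :=
  Finset.prod_nonneg fun _ _ => (gaussWeight_pos _).le

theorem integral_gaussMeasure {m n : ℕ} {E : Type*} [NormedAddCommGroup E] [NormedSpace ℝ E]
    (f : (Fin n → Fin m → ℝ) → E) :
    ∫ x, f x ∂gaussMeasure m n = ∫ x, (∏ i, gaussWeight (x i)) • f x := by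
  rw [gaussMeasure, integral_withDensity_eq_integral_toReal_smul (by fun_prop)
    (Eventually.of_forall fun _ => ENNReal.ofReal_lt_top)]
  simp only [ENNReal.toReal_ofReal (prod_gaussWeight_nonneg _)]

theorem integrable_gaussMeasure_iff {m n : ℕ} {f : (Fin n → Fin m → ℝ) → ℝ} :
    Integrable f (gaussMeasure m n) ↔ Integrable fun x => f x * ∏ i, gaussWeight (x i) := by
  rw [gaussMeasure, integrable_withDensity_iff (by fun_prop)
    (Eventually.of_forall fun _ => ENNReal.ofReal_lt_top)]
  simp only [ENNReal.toReal_ofReal (prod_gaussWeight_nonneg _)]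

instance isFiniteMeasure_gaussMeasure (m n : ℕ) : IsFiniteMeasure (gaussMeasure m n) := by
  have h : Integrable (fun _ => (1 : ℝ)) (gaussMeasure m n) := by
    rw [integrable_gaussMeasure_iff]
    simpa only [one_mul] using integrable_prod_gaussWeight m n
  exact ((integrable_const_iff_isFiniteMeasure one_ne_zero).1 h)

theorem norm_le_exp_sum_sq {m n : ℕ} (x : Fin n → Fin m → ℝ) :
    ‖x‖ ≤ rexp (1 / 4 * ∑ i, ∑ j, x i j ^ 2) := by
  have hT0 : 0 ≤ ∑ i, ∑ j, x i j ^ 2 :=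
    Finset.sum_nonneg fun i _ => Finset.sum_nonneg fun j _ => sq_nonneg _
  have hnorm : ‖x‖ ≤ √(∑ i, ∑ j, x i j ^ 2) := by
    refine (pi_norm_le_iff_of_nonneg (Real.sqrt_nonneg _)).2 fun i =>
      (pi_norm_le_iff_of_nonneg (Real.sqrt_nonneg _)).2 fun j => ?_
    refine Real.abs_le_sqrt ?_
    have h2 : x i j ^ 2 ≤ ∑ j, x i j ^ 2 :=
      Finset.single_le_sum (f := fun j => x i j ^ 2) (fun j _ => sq_nonneg _) (Finset.mem_univ j)
    have h3 : ∑ j, x i j ^ 2 ≤ ∑ i, ∑ j, x i j ^ 2 :=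
      Finset.single_le_sum (f := fun i => ∑ j, x i j ^ 2)
        (fun i _ => Finset.sum_nonneg fun j _ => sq_nonneg _) (Finset.mem_univ i)
    exact h2.trans h3
  have h1 := Real.add_one_le_exp (1 / 4 * ∑ i, ∑ j, x i j ^ 2)
  nlinarith [Real.sq_sqrt hT0, sq_nonneg (1 - √(∑ i, ∑ j, x i j ^ 2) / 2)]

theorem integrable_norm_gaussMeasure (m n : ℕ) : Integrable (fun x => ‖x‖) (gaussMeasure m n) := by
  rw [integrable_gaussMeasure_iff]
  have h0 : Integrable fun y : Fin m → ℝ => rexp (-(1 / 4) * ∑ j, y j ^ 2) :=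
    integrable_exp_neg_mul_sum_sq (b := 1 / 4) (by norm_num)
  have hprod : ∀ g : (Fin m → ℝ) → ℝ, Integrable g →
      Integrable fun x : Fin n → Fin m → ℝ => ∏ i, g (x i) := fun g hg =>
    Integrable.fintype_prod (f := fun _ y => g y) fun _ => hg
  have h1 := hprod _ h0
  have hm : Measurable fun x : Fin n → Fin m → ℝ => ‖x‖ * ∏ i, gaussWeight (x i) :=
    measurable_norm.mul (by fun_prop)
  refine h1.mono' hm.aestronglyMeasurable (Eventually.of_forall fun x => ?_)
  rw [Real.norm_of_nonneg (mul_nonneg (norm_nonneg x) (prod_gaussWeight_nonneg x))]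
  refine (mul_le_mul_of_nonneg_right (norm_le_exp_sum_sq x) (prod_gaussWeight_nonneg x)).trans
    (le_of_eq ?_)
  simp only [gaussWeight, ← Real.exp_sum, ← Finset.mul_sum, ← Real.exp_add]
  congr 1
  ring

theorem integral_rpow_le_of_integral_exp_le {X : Type*} [MeasurableSpace X] {γ : Measure X}
    [IsFiniteMeasure γ] {Y Z : X → ℝ} (hY : Measurable Y) (hZ : Measurable Z) (hY0 : ∀ x, 0 ≤ Y x)
    (hZ0 : ∀ x, 0 ≤ Z x) {a : ℝ} (ha : 0 < a) (ha1 : a ≤ 1)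
    (hYi : Integrable (fun x => Y x ^ a) γ) (hZi : Integrable (fun x => Z x ^ a) γ)
    (h : ∀ t : ℝ, 0 ≤ t → ∫ x, rexp (-(t * Y x)) ∂γ ≤ ∫ x, rexp (-(t * Z x)) ∂γ) :
    ∫ x, Z x ^ a ∂γ ≤ ∫ x, Y x ^ a ∂γ := by
  obtain ⟨ν, hν, hνle, hνlim⟩ := exists_measure_tendsto_integral_one_sub_exp ha ha1
  have hbd : ∀ (t : NNReal) {y : ℝ}, 0 ≤ y → 1 - rexp (-(t * y)) ∈ Set.Icc 0 1 := fun t y hy => by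
    have h1 : rexp (-(t * y)) ≤ 1 := Real.exp_le_one_iff.2 (neg_nonpos.2 (by positivity))
    have h2 := Real.exp_pos (-(t * y))
    constructor <;> linarith
  have hint : ∀ (k : ℕ) {W : X → ℝ}, Measurable W → (∀ x, 0 ≤ W x) →
      Integrable (fun z : X × NNReal => 1 - rexp (-(z.2 * W z.1))) (γ.prod (ν k)) :=
    fun k W hW hW0 => Integrable.of_bound (Measurable.aestronglyMeasurable (by fun_prop)) 1
      (Eventually.of_forall fun z => by
        rw [Real.norm_of_nonneg (hbd _ (hW0 _)).1]; exact (hbd _ (hW0 _)).2)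
  have hlim : ∀ {W : X → ℝ}, Measurable W → (∀ x, 0 ≤ W x) → Integrable (fun x => W x ^ a) γ →
      Tendsto (fun k => ∫ x, ∫ t : NNReal, (1 - rexp (-(t * W x))) ∂ν k ∂γ) atTop
        (nhds (∫ x, W x ^ a ∂γ)) := by
    intro W hW hW0 hWi
    refine tendsto_integral_of_dominated_convergence (fun x => W x ^ a) (fun k => ?_) hWi
      (fun k => Eventually.of_forall fun x => ?_)
      (Eventually.of_forall fun x => hνlim _ (hW0 x))
    · exact (hint k hW hW0).integral_prod_left.aestronglyMeasurable
    · rw [Real.norm_of_nonneg (integral_nonneg fun t => (hbd t (hW0 x)).1)]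
      exact hνle _ (hW0 x) k
  refine le_of_tendsto_of_tendsto' (hlim hZ hZ0 hZi) (hlim hY hY0 hYi) fun k => ?_
  rw [integral_integral_swap (f := fun x (t : NNReal) => 1 - rexp (-(t * Z x))) (hint k hZ hZ0),
    integral_integral_swap (f := fun x (t : NNReal) => 1 - rexp (-(t * Y x))) (hint k hY hY0)]
  refine integral_mono (hint k hZ hZ0).integral_prod_right (hint k hY hY0).integral_prod_right
    fun t => ?_
  have hexp : ∀ {W : X → ℝ}, Measurable W → (∀ x, 0 ≤ W x) →
      Integrable (fun x => rexp (-(t * W x))) γ := fun hW hW0 =>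
    Integrable.of_bound (Measurable.aestronglyMeasurable (by fun_prop)) 1
      (Eventually.of_forall fun x => by
        rw [Real.norm_of_nonneg (Real.exp_pos _).le]; linarith [(hbd t (hW0 x)).1])
  simp only
  rw [integral_sub (integrable_const _) (hexp hZ hZ0), integral_sub (integrable_const _)
    (hexp hY hY0)]
  linarith [h t t.2]

/-- The `p`-th power of the norm of `X_p(μ)`. -/
def lewisPow {m : ℕ} (p : ℝ) (μ : Measure (Metric.sphere (0 : EuclideanSpace ℝ (Fin m)) 1))
    (x : Fin m → ℝ) : ℝ :=
  ∫ u, |∑ k, x k * (u : EuclideanSpace ℝ (Fin m)) k| ^ p ∂μ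

theorem lewisPow_nonneg {m : ℕ} (p : ℝ)
    (μ : Measure (Metric.sphere (0 : EuclideanSpace ℝ (Fin m)) 1)) (x : Fin m → ℝ) :
    0 ≤ lewisPow p μ x :=
  integral_nonneg fun _ => Real.rpow_nonneg (abs_nonneg _) _

theorem abs_sum_mul_sphere_le {m : ℕ} (x : Fin m → ℝ)
    (u : Metric.sphere (0 : EuclideanSpace ℝ (Fin m)) 1) :
    |∑ k, x k * (u : EuclideanSpace ℝ (Fin m)) k| ≤ m * ‖x‖ := by
  refine (Finset.abs_sum_le_sum_abs _ _).trans ?_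
  refine (Finset.sum_le_card_nsmul _ _ ‖x‖ fun k _ => ?_).trans (by simp)
  rw [abs_mul]
  have h1 : |(u : EuclideanSpace ℝ (Fin m)) k| ≤ 1 := by
    have := PiLp.norm_apply_le (u : EuclideanSpace ℝ (Fin m)) k
    rwa [norm_eq_of_mem_sphere u] at this
  calc |x k| * _ ≤ |x k| * 1 := mul_le_mul_of_nonneg_left h1 (abs_nonneg _)
    _ ≤ ‖x‖ := by rw [mul_one]; exact norm_le_pi_norm x k

theorem continuous_abs_sum_mul_sphere_rpow {m : ℕ} {p : ℝ} (hp : 0 ≤ p) :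
    Continuous fun z : (Fin m → ℝ) × Metric.sphere (0 : EuclideanSpace ℝ (Fin m)) 1 =>
      |∑ k, z.1 k * (z.2 : EuclideanSpace ℝ (Fin m)) k| ^ p :=
  Continuous.rpow_const (by fun_prop) fun _ => Or.inr hp

theorem integrable_abs_sum_mul_sphere_rpow {m : ℕ} {p : ℝ} (hp : 0 ≤ p)
    (μ : Measure (Metric.sphere (0 : EuclideanSpace ℝ (Fin m)) 1)) [IsFiniteMeasure μ]
    (x : Fin m → ℝ) :
    Integrable (fun u : Metric.sphere (0 : EuclideanSpace ℝ (Fin m)) 1 =>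
      |∑ k, x k * (u : EuclideanSpace ℝ (Fin m)) k| ^ p) μ := by
  refine Integrable.of_bound ((continuous_abs_sum_mul_sphere_rpow hp).comp
    (Continuous.prodMk_right x)).aestronglyMeasurable ((m * ‖x‖) ^ p)
    (Eventually.of_forall fun u => ?_)
  rw [Real.norm_of_nonneg (Real.rpow_nonneg (abs_nonneg _) _)]
  exact Real.rpow_le_rpow (abs_nonneg _) (abs_sum_mul_sphere_le x u) hp

theorem lewisPow_le {m : ℕ} {p : ℝ} (hp : 0 ≤ p)
    (μ : Measure (Metric.sphere (0 : EuclideanSpace ℝ (Fin m)) 1)) [IsFiniteMeasure μ]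
    (x : Fin m → ℝ) : lewisPow p μ x ≤ μ.real Set.univ * (m * ‖x‖) ^ p := by
  refine (integral_mono (integrable_abs_sum_mul_sphere_rpow hp μ x) (integrable_const _)
    fun u => Real.rpow_le_rpow (abs_nonneg _) (abs_sum_mul_sphere_le x u) hp).trans ?_
  rw [integral_const, smul_eq_mul]

theorem continuous_lewisPow {m : ℕ} {p : ℝ} (hp : 0 ≤ p)
    (μ : Measure (Metric.sphere (0 : EuclideanSpace ℝ (Fin m)) 1)) [IsFiniteMeasure μ] :
    Continuous (lewisPow p μ) :=
  continuous_parametric_integral_of_continuous (s := Set.univ)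
    (continuous_abs_sum_mul_sphere_rpow hp) isCompact_univ |>.congr fun x => by
      rw [lewisPow, Measure.restrict_univ]

theorem isShrinkMonotone_exp_neg_lewisPow {m n : ℕ} {θ φ : Fin n → ℝ}
    (hθ : ∑ i, θ i ^ 2 = 1) (hφ : ∑ i, φ i ^ 2 = 1)
    (hmaj : IsMajorizedBy (fun i => θ i ^ 2) (fun i => φ i ^ 2)) {p : ℝ} (hp : 0 < p) (hp2 : p ≤ 2)
    (μ : Measure (Metric.sphere (0 : EuclideanSpace ℝ (Fin m)) 1)) [IsFiniteMeasure μ]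
    [hne : Nonempty (Metric.sphere (0 : EuclideanSpace ℝ (Fin m)) 1)] {t : ℝ} (ht : 0 ≤ t) :
    IsShrinkMonotone θ φ fun x => rexp (-(t * lewisPow p μ x)) := by
  obtain ⟨ν, hν, hνle, hνlim⟩ :=
    exists_measure_tendsto_integral_one_sub_exp (a := p / 2) (by linarith) (by linarith)
  lift t to NNReal using ht
  have hpow : ∀ y : ℝ, (y ^ 2) ^ (p / 2) = |y| ^ p := fun y => by
    rw [← sq_abs, ← Real.rpow_natCast, ← Real.rpow_mul (abs_nonneg _)]
    congr 1
    push_cast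
    ring
  have hv : Measurable fun ω : NNReal × Metric.sphere (0 : EuclideanSpace ℝ (Fin m)) 1 =>
      ((ω.2 : EuclideanSpace ℝ (Fin m)) : Fin m → ℝ) := by fun_prop
  have hbd : ∀ (t : NNReal) (y : ℝ), 1 - rexp (-(t * y ^ 2)) ∈ Set.Icc 0 1 := fun t y => by
    have h1 : rexp (-(t * y ^ 2)) ≤ 1 := Real.exp_le_one_iff.2 (neg_nonpos.2 (by positivity))
    have h2 := Real.exp_pos (-(t * y ^ 2))
    constructor <;> linarith
  refine IsShrinkMonotone.of_tendsto (fun k => isShrinkMonotone_exp_neg_integral hθ hφ hmaj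
    ((t • ν k).prod μ) (t := fun ω => (ω.1 : ℝ)) (by fun_prop) (fun ω => ω.1.2) hv
    (ω₀ := (0, hne.some)) rfl) fun x => ?_
  refine (Real.continuous_exp.tendsto _).comp (Tendsto.neg ?_)
  have hint : ∀ k, Integrable (fun ω : NNReal × Metric.sphere (0 : EuclideanSpace ℝ (Fin m)) 1 =>
      1 - rexp (-(ω.1 * (∑ j, x j * (ω.2 : EuclideanSpace ℝ (Fin m)) j) ^ 2)))
      ((t • ν k).prod μ) := fun k =>
    Integrable.of_bound (Measurable.aestronglyMeasurable (by fun_prop)) 1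
      (Eventually.of_forall fun ω => by
        rw [Real.norm_of_nonneg (hbd _ _).1]; exact (hbd _ _).2)
  have heq : ∀ k, ∫ ω : NNReal × Metric.sphere (0 : EuclideanSpace ℝ (Fin m)) 1,
      (1 - rexp (-(ω.1 * (∑ j, x j * (ω.2 : EuclideanSpace ℝ (Fin m)) j) ^ 2)))
      ∂((t • ν k).prod μ) = ∫ u : Metric.sphere (0 : EuclideanSpace ℝ (Fin m)) 1,
      t * ∫ s : NNReal, (1 - rexp (-(s * (∑ j, x j * (u : EuclideanSpace ℝ (Fin m)) j) ^ 2)))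
        ∂ν k ∂μ := by
    intro k
    rw [integral_prod_symm _ (hint k)]
    refine integral_congr_ae (Eventually.of_forall fun u => ?_)
    simp only
    rw [integral_smul_nnreal_measure]
    rfl
  rw [lewisPow, ← integral_const_mul]
  simp only [heq]
  refine tendsto_integral_of_dominated_convergence
    (fun u => t * |∑ k, x k * (u : EuclideanSpace ℝ (Fin m)) k| ^ p) (fun k => ?_)
    ((integrable_abs_sum_mul_sphere_rpow hp.le μ x).const_mul _)
    (fun k => Eventually.of_forall fun u => ?_) (Eventually.of_forall fun u => ?_)
  · refine AEStronglyMeasurable.const_mul ?_ _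
    refine StronglyMeasurable.aestronglyMeasurable ?_
    refine StronglyMeasurable.integral_prod_left (f := fun (s : NNReal)
      (u : Metric.sphere (0 : EuclideanSpace ℝ (Fin m)) 1) =>
      1 - rexp (-(s * (∑ j, x j * (u : EuclideanSpace ℝ (Fin m)) j) ^ 2))) ?_
    exact Measurable.stronglyMeasurable (by fun_prop)
  · have h0 : 0 ≤ ∫ s : NNReal,
        (1 - rexp (-(s * (∑ j, x j * (u : EuclideanSpace ℝ (Fin m)) j) ^ 2))) ∂ν k :=
      integral_nonneg fun s => (hbd s _).1
    rw [Real.norm_of_nonneg (mul_nonneg t.coe_nonneg h0), ← hpow]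
    exact mul_le_mul_of_nonneg_left (hνle _ (sq_nonneg _) k) t.2
  · rw [← hpow]
    exact (hνlim _ (sq_nonneg _)).const_mul _

theorem integral_exp_neg_sum_lewisPow_le {m n : ℕ} {θ φ : Fin n → ℝ}
    (hθ : ∑ i, θ i ^ 2 = 1) (hφ : ∑ i, φ i ^ 2 = 1)
    (hmaj : IsMajorizedBy (fun i => θ i ^ 2) (fun i => φ i ^ 2)) {p : ℝ} (hp : 0 < p) (hp2 : p ≤ 2)
    (μ : Measure (Metric.sphere (0 : EuclideanSpace ℝ (Fin m)) 1)) [IsFiniteMeasure μ]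
    [Nonempty (Metric.sphere (0 : EuclideanSpace ℝ (Fin m)) 1)] {t : ℝ} (ht : 0 ≤ t) :
    ∫ x, rexp (-(t * ∑ i, lewisPow p μ (shrinkMap 1 θ x i))) ∂gaussMeasure m n ≤
      ∫ x, rexp (-(t * ∑ i, lewisPow p μ (shrinkMap 1 φ x i))) ∂gaussMeasure m n := by
  have hmono := isShrinkMonotone_exp_neg_lewisPow hθ hφ hmaj hp hp2 μ ht
  have hcont := continuous_lewisPow hp.le μ
  have hτ : Tendsto (fun k : ℕ => 1 - 1 / ((k : ℝ) + 1)) atTop (nhds 1) := by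
    simpa using tendsto_const_nhds.sub (tendsto_one_div_add_atTop_nhds_zero_nat (𝕜 := ℝ))
  have hlim : ∀ θ : Fin n → ℝ, Tendsto (fun k : ℕ => ∫ x : Fin n → Fin m → ℝ,
      (∏ i, rexp (-(t * lewisPow p μ (shrinkMap (1 - 1 / ((k : ℝ) + 1)) θ x i)))) *
        ∏ i, gaussWeight (x i)) atTop
      (nhds (∫ x, rexp (-(t * ∑ i, lewisPow p μ (shrinkMap 1 θ x i))) ∂gaussMeasure m n)) := by
    intro θ
    have heq : ∫ x, rexp (-(t * ∑ i, lewisPow p μ (shrinkMap 1 θ x i))) ∂gaussMeasure m n =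
        ∫ x : Fin n → Fin m → ℝ, (∏ i, rexp (-(t * lewisPow p μ (shrinkMap 1 θ x i)))) *
          ∏ i, gaussWeight (x i) := by
      rw [integral_gaussMeasure]
      refine integral_congr_ae (Eventually.of_forall fun x => ?_)
      simp only
      rw [← Real.exp_sum, Finset.sum_neg_distrib, ← Finset.mul_sum, smul_eq_mul, mul_comm]
    rw [heq]
    refine tendsto_integral_prod_mul_gaussWeight
      (F := fun k x i => rexp (-(t * lewisPow p μ (shrinkMap (1 - 1 / ((k : ℝ) + 1)) θ x i))))
      (fun k i => hmono.1.comp ((measurable_pi_apply i).comp (measurable_shrinkMap _ θ)))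
      (fun k x i => hmono.2.1 _) fun x i => ?_
    have hc : Continuous fun τ : ℝ => rexp (-(t * lewisPow p μ (shrinkMap τ θ x i))) := by
      have : Continuous fun τ : ℝ => shrinkMap τ θ x i := continuous_pi fun j => by
        simp only [shrinkMap_apply]; fun_prop
      fun_prop
    exact (hc.tendsto 1).comp hτ
  refine le_of_tendsto_of_tendsto' (hlim θ) (hlim φ) fun k => hmono.2.2 _ ?_ ?_
  · have : 1 / ((k : ℝ) + 1) ≤ 1 := by
      rw [div_le_one (by positivity)]
      linarith [(Nat.cast_nonneg k : (0 : ℝ) ≤ k)]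
    linarith
  · have : 0 < 1 / ((k : ℝ) + 1) := by positivity
    linarith

theorem integral_rpow_sum_lewisPow_le {m n : ℕ} {θ φ : Fin n → ℝ}
    (hθ : ∑ i, θ i ^ 2 = 1) (hφ : ∑ i, φ i ^ 2 = 1)
    (hmaj : IsMajorizedBy (fun i => θ i ^ 2) (fun i => φ i ^ 2)) {p : ℝ} (hp : 1 ≤ p) (hp2 : p ≤ 2)
    (μ : Measure (Metric.sphere (0 : EuclideanSpace ℝ (Fin m)) 1)) [IsFiniteMeasure μ]
    [Nonempty (Metric.sphere (0 : EuclideanSpace ℝ (Fin m)) 1)] :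
    ∫ x, (∑ i, lewisPow p μ (shrinkMap 1 φ x i)) ^ (1 / p) ∂gaussMeasure m n ≤
      ∫ x, (∑ i, lewisPow p μ (shrinkMap 1 θ x i)) ^ (1 / p) ∂gaussMeasure m n := by
  have hp0 : 0 < p := by linarith
  have hcont := continuous_lewisPow hp0.le μ
  have hpos : ∀ (θ : Fin n → ℝ) x, 0 ≤ ∑ i, lewisPow p μ (shrinkMap 1 θ x i) := fun θ x =>
    Finset.sum_nonneg fun i _ => lewisPow_nonneg p μ _
  have hmeas : ∀ θ : Fin n → ℝ, Measurable fun x => ∑ i, lewisPow p μ (shrinkMap 1 θ x i) :=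
    fun θ => Finset.measurable_sum _ fun i _ => hcont.measurable.comp
      ((measurable_pi_apply i).comp (measurable_shrinkMap 1 θ))
  have hint : ∀ θ : Fin n → ℝ, Integrable (fun x =>
      (∑ i, lewisPow p μ (shrinkMap 1 θ x i)) ^ (1 / p)) (gaussMeasure m n) := by
    intro θ
    let A := LinearMap.toContinuousLinearMap
      (shrinkMap 1 θ : (Fin n → Fin m → ℝ) →ₗ[ℝ] (Fin n → Fin m → ℝ))
    refine ((integrable_norm_gaussMeasure m n).const_mul
      ((n * μ.real Set.univ) ^ (1 / p) * (m * ‖A‖))).mono'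
      ((hmeas θ).pow_const _).aestronglyMeasurable (Eventually.of_forall fun x => ?_)
    rw [Real.norm_of_nonneg (Real.rpow_nonneg (hpos θ x) _)]
    have hA : ∀ i, ‖shrinkMap 1 θ x i‖ ≤ ‖A‖ * ‖x‖ := fun i =>
      (norm_le_pi_norm (shrinkMap 1 θ x) i).trans (A.le_opNorm x)
    have h1 : ∑ i, lewisPow p μ (shrinkMap 1 θ x i) ≤
        (n * μ.real Set.univ) * (m * ‖A‖ * ‖x‖) ^ p := by
      refine (Finset.sum_le_card_nsmul _ _ (μ.real Set.univ * (m * ‖A‖ * ‖x‖) ^ p)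
        fun i _ => ?_).trans (le_of_eq (by simp; ring))
      refine (lewisPow_le hp0.le μ _).trans (mul_le_mul_of_nonneg_left ?_ measureReal_nonneg)
      refine Real.rpow_le_rpow (by positivity) ?_ hp0.le
      rw [mul_assoc]
      exact mul_le_mul_of_nonneg_left (hA i) (Nat.cast_nonneg m)
    refine (Real.rpow_le_rpow (hpos θ x) h1 (by positivity)).trans (le_of_eq ?_)
    rw [Real.mul_rpow (by positivity) (by positivity), ← Real.rpow_mul (by positivity),
      mul_one_div_cancel hp0.ne', Real.rpow_one]
    ring
  exact integral_rpow_le_of_integral_exp_le (hmeas θ) (hmeas φ) (hpos θ) (hpos φ)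
    (by positivity) ((div_le_one hp0).2 hp) (hint θ) (hint φ)
    fun t ht => integral_exp_neg_sum_lewisPow_le hθ hφ hmaj hp0 hp2 μ ht

theorem charFun_eq_of_norm_eq {E : Type*} [NormedAddCommGroup E] [InnerProductSpace ℝ E]
    [FiniteDimensional ℝ E] [MeasurableSpace E] [BorelSpace E] {σ : Measure E}
    (hσ : ∀ g : E ≃ₗᵢ[ℝ] E, σ.map g = σ) {s t : E} (hst : ‖s‖ = ‖t‖) :
    charFun σ s = charFun σ t := by
  set g : E ≃ₗᵢ[ℝ] E := (ℝ ∙ (s - t))ᗮ.reflection with hg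
  have hgs : g s = t := Submodule.reflection_sub hst
  conv_rhs => rw [← hσ g, charFun_apply,
    integral_map g.continuous.aemeasurable (by fun_prop), ← hgs]
  simp only [charFun_apply, LinearIsometryEquiv.inner_map_map]

/-- Two rotation-invariant finite measures concentrated on the unit sphere are proportional. -/
theorem smul_eq_smul_of_rotation_invariant {E : Type*} [NormedAddCommGroup E]
    [InnerProductSpace ℝ E] [FiniteDimensional ℝ E] [MeasurableSpace E] [BorelSpace E]
    {σ ν : Measure E} [IsFiniteMeasure σ] [IsFiniteMeasure ν]
    (hσ : ∀ g : E ≃ₗᵢ[ℝ] E, σ.map g = σ) (hν : ∀ g : E ≃ₗᵢ[ℝ] E, ν.map g = ν)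
    (hσ1 : ∀ᵐ x ∂σ, ‖x‖ = 1) (hν1 : ∀ᵐ x ∂ν, ‖x‖ = 1) :
    ν Set.univ • σ = σ Set.univ • ν := by
  have hfin : ∀ (c : ℝ≥0∞) (κ : Measure E) [IsFiniteMeasure κ], c ≠ ⊤ →
      IsFiniteMeasure (c • κ) := fun c κ _ hc =>
    ⟨by rw [Measure.smul_apply]; exact ENNReal.mul_lt_top hc.lt_top (measure_lt_top _ _)⟩
  have := hfin _ σ (measure_ne_top ν Set.univ)
  have := hfin _ ν (measure_ne_top σ Set.univ)
  refine Measure.ext_of_charFun (funext fun t => ?_)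
  have hswap : ∫ v, charFun σ (‖t‖ • v) ∂ν = ∫ u, charFun ν (‖t‖ • u) ∂σ := by
    simp only [charFun_apply]
    rw [integral_integral_swap]
    · refine integral_congr_ae (Eventually.of_forall fun x => integral_congr_ae
        (Eventually.of_forall fun y => ?_))
      simp only [real_inner_smul_right, real_inner_comm x y]
    · refine Integrable.of_bound (Continuous.aestronglyMeasurable (by fun_prop)) 1
        (Eventually.of_forall fun z => ?_)
      rw [Function.uncurry, Complex.norm_exp_ofReal_mul_I]
  have hl : ∀ (κ κ' : Measure E), (∀ g : E ≃ₗᵢ[ℝ] E, κ.map g = κ) → (∀ᵐ x ∂κ', ‖x‖ = 1) →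
      ∫ v, charFun κ (‖t‖ • v) ∂κ' = κ'.real Set.univ • charFun κ t := by
    intro κ κ' hκ hκ'
    rw [← integral_const]
    refine integral_congr_ae ?_
    filter_upwards [hκ'] with v hv
    exact charFun_eq_of_norm_eq hκ (by rw [norm_smul, norm_norm, hv, mul_one])
  rw [hl σ ν hσ hν1, hl ν σ hν hσ1] at hswap
  simpa only [charFun_apply, integral_smul_measure, Measure.real] using hswap

/-- The push-forward to the sphere of the standard Gaussian measure weighted by the norm. -/
def gaussSphere (E : Type*) [NormedAddCommGroup E] [InnerProductSpace ℝ E]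
    [FiniteDimensional ℝ E] [MeasurableSpace E] : Measure E :=
  ((ProbabilityTheory.stdGaussian E).withDensity fun y => ENNReal.ofReal ‖y‖).map
    fun y => ‖y‖⁻¹ • y

section

variable {E : Type*} [NormedAddCommGroup E] [InnerProductSpace ℝ E]
  [FiniteDimensional ℝ E] [MeasurableSpace E] [BorelSpace E]

theorem integrable_norm_stdGaussian :
    Integrable (fun y => ‖y‖) (ProbabilityTheory.stdGaussian E) := by
  have := ProbabilityTheory.IsGaussian.memLp_id (ProbabilityTheory.stdGaussian E) 1 (by simp)
  exact (memLp_one_iff_integrable.1 this).norm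

instance isFiniteMeasure_gaussSphere : IsFiniteMeasure (gaussSphere E) := by
  have : IsFiniteMeasure
      ((ProbabilityTheory.stdGaussian E).withDensity fun y => ENNReal.ofReal ‖y‖) :=
    isFiniteMeasure_withDensity_ofReal integrable_norm_stdGaussian.2
  rw [gaussSphere]
  infer_instance

theorem ae_norm_eq_one_gaussSphere : ∀ᵐ x ∂gaussSphere E, ‖x‖ = 1 := by
  rw [gaussSphere, ae_map_iff (Measurable.aemeasurable (by fun_prop))
    (measurableSet_eq_fun measurable_norm measurable_const),
    ae_withDensity_iff (by fun_prop)]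
  refine Eventually.of_forall fun y hy => ?_
  have hy' : ‖y‖ ≠ 0 := fun h => hy (by rw [h, ENNReal.ofReal_zero])
  rw [norm_smul, norm_inv, norm_norm, inv_mul_cancel₀ hy']

theorem map_gaussSphere (g : E ≃ₗᵢ[ℝ] E) : (gaussSphere E).map g = gaussSphere E := by
  have hg : Measurable g := g.continuous.measurable
  refine Measure.ext_of_lintegral _ fun f hf => ?_
  rw [gaussSphere, lintegral_map hf hg, lintegral_map (f := fun a => f (g a)) (hf.comp hg) (by fun_prop),
    lintegral_map hf (by fun_prop),
    lintegral_withDensity_eq_lintegral_mul _ (by fun_prop) (by fun_prop),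
    lintegral_withDensity_eq_lintegral_mul _ (by fun_prop) (by fun_prop)]
  conv_rhs => rw [← ProbabilityTheory.stdGaussian_map g, lintegral_map (by fun_prop) hg]
  simp only [Pi.mul_apply, map_smul, LinearIsometryEquiv.norm_map]

theorem integral_gaussSphere {Φ : E → ℝ} (hΦ : Continuous Φ)
    (hhom : ∀ r : ℝ, 0 ≤ r → ∀ y, Φ (r • y) = r * Φ y) :
    ∫ u, Φ u ∂gaussSphere E = ∫ y, Φ y ∂ProbabilityTheory.stdGaussian E := by
  rw [gaussSphere, integral_map (Measurable.aemeasurable (by fun_prop)) hΦ.aestronglyMeasurable,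
    integral_withDensity_eq_integral_toReal_smul (by fun_prop)
    (Eventually.of_forall fun _ => ENNReal.ofReal_lt_top)]
  refine integral_congr_ae (Eventually.of_forall fun y => ?_)
  simp only
  rw [ENNReal.toReal_ofReal (norm_nonneg _), smul_eq_mul, ← hhom _ (norm_nonneg y), smul_smul]
  rcases eq_or_ne y 0 with rfl | hy
  · simp
  · rw [mul_inv_cancel₀ (norm_ne_zero_iff.2 hy), one_smul]

theorem gaussSphere_ne_zero {u : E} (hu : ‖u‖ = 1) : gaussSphere E ≠ 0 := by
  intro h0
  rw [gaussSphere, Measure.map_eq_zero_iff (Measurable.aemeasurable (by fun_prop)),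
    withDensity_eq_zero_iff (by fun_prop)] at h0
  have h1 : charFun (ProbabilityTheory.stdGaussian E) u = 1 := by
    rw [charFun_apply]
    have : ∀ᵐ y ∂ProbabilityTheory.stdGaussian E,
        Complex.exp ((inner ℝ y u : ℝ) * Complex.I) = 1 := by
      filter_upwards [h0] with y hy
      have : y = 0 := norm_eq_zero.1 (le_antisymm (ENNReal.ofReal_eq_zero.1 hy) (norm_nonneg y))
      simp [this]
    rw [integral_congr_ae this]
    simp
  rw [ProbabilityTheory.charFun_stdGaussian, hu] at h1
  have h2 := congrArg norm h1
  rw [Complex.norm_exp] at h2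
  norm_num at h2

end

theorem exists_average_sphere_eq (d : ℕ) : ∃ c : ℝ, 0 ≤ c ∧
    ∀ Φ : EuclideanSpace ℝ (Fin d) → ℝ, Continuous Φ →
      (∀ r : ℝ, 0 ≤ r → ∀ y, Φ (r • y) = r * Φ y) →
      ⨍ u in Metric.sphere (0 : EuclideanSpace ℝ (Fin d)) 1, Φ u ∂μH[(d : ℝ) - 1] =
        c * ∫ y, Φ y ∂ProbabilityTheory.stdGaussian (EuclideanSpace ℝ (Fin d)) := by
  set E := EuclideanSpace ℝ (Fin d)
  set S := Metric.sphere (0 : E) 1 with hS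
  set σ : Measure E := μH[(d : ℝ) - 1].restrict S with hσ
  by_cases hdeg : σ.real Set.univ = 0
  · refine ⟨0, le_rfl, fun Φ _ _ => ?_⟩
    rw [average_eq, hdeg, inv_zero, zero_smul, zero_mul]
  have hne0 : σ Set.univ ≠ 0 := fun h => hdeg (by rw [Measure.real, h, ENNReal.toReal_zero])
  have hfin : IsFiniteMeasure σ := ⟨lt_top_iff_ne_top.2 fun h =>
    hdeg (by rw [Measure.real, h, ENNReal.toReal_top])⟩
  obtain ⟨u, hu⟩ : S.Nonempty := by
    rw [Set.nonempty_iff_ne_empty]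
    intro h
    rw [hσ, h, Measure.restrict_empty] at hne0
    exact hne0 rfl
  have hinv : ∀ g : E ≃ₗᵢ[ℝ] E, σ.map g = σ := by
    intro g
    have hpre : g ⁻¹' S = S := by
      ext x
      simp [hS]
    have h := (MeasurePreserving.mk (μa := μH[(d : ℝ) - 1]) (μb := μH[(d : ℝ) - 1])
      g.continuous.measurable (by
        rw [g.isometry.map_hausdorffMeasure (Or.inr g.surjective), g.surjective.range_eq,
          Measure.restrict_univ])).restrict_preimage (s := S) Metric.isClosed_sphere.measurableSet
    rw [hpre] at h
    exact h.map_eq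
  have hsph : ∀ᵐ x ∂σ, ‖x‖ = 1 := by
    filter_upwards [ae_restrict_mem Metric.isClosed_sphere.measurableSet] with x hx
    exact mem_sphere_zero_iff_norm.1 hx
  have hkey := smul_eq_smul_of_rotation_invariant hinv map_gaussSphere hsph
    ae_norm_eq_one_gaussSphere
  have hν0 : (gaussSphere E).real Set.univ ≠ 0 := by
    rw [Measure.real, ENNReal.toReal_ne_zero]
    exact ⟨fun h => gaussSphere_ne_zero (mem_sphere_zero_iff_norm.1 hu)
      (Measure.measure_univ_eq_zero.1 h), measure_ne_top _ _⟩
  refine ⟨((gaussSphere E).real Set.univ)⁻¹, inv_nonneg.2 measureReal_nonneg,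
    fun Φ hΦ hhom => ?_⟩
  have h := congrArg (fun κ : Measure E => ∫ u, Φ u ∂κ) hkey
  simp only [integral_smul_measure, smul_eq_mul] at h
  rw [integral_gaussSphere hΦ hhom] at h
  rw [average_eq, smul_eq_mul, inv_mul_eq_iff_eq_mul₀ hdeg, mul_left_comm,
    eq_inv_mul_iff_mul_eq₀ hν0]
  exact h

theorem sum_mul_eq_inner_of_isometry {ι κ : Type*} [Fintype ι] [Fintype κ]
    {T : EuclideanSpace ℝ ι →ₗ[ℝ] (κ → ℝ)}
    (hT : ∀ y, ∑ c, T y c ^ 2 = ∑ i, y i ^ 2) (y z : EuclideanSpace ℝ ι) :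
    ∑ c, T y c * T z c = inner ℝ y z := by
  have h := hT (y + z)
  simp only [map_add, Pi.add_apply, PiLp.add_apply, add_sq, Finset.sum_add_distrib, hT, mul_assoc,
    ← Finset.mul_sum] at h
  rw [PiLp.inner_apply]
  simp only [RCLike.inner_apply, conj_trivial, mul_comm (z.ofLp _)]
  linarith

/-- The adjoint of a linear map from `ℝ^d` to `(ℝ^m)^n`. -/
def blockAdjoint {m n d : ℕ} (T : EuclideanSpace ℝ (Fin d) →ₗ[ℝ] (Fin n × Fin m → ℝ))
    (x : Fin n → Fin m → ℝ) : EuclideanSpace ℝ (Fin d) :=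
  ∑ c, (∑ i, ∑ j, x i j * T (EuclideanSpace.basisFun (Fin d) ℝ c) (i, j)) •
    EuclideanSpace.basisFun (Fin d) ℝ c

theorem continuous_blockAdjoint {m n d : ℕ}
    (T : EuclideanSpace ℝ (Fin d) →ₗ[ℝ] (Fin n × Fin m → ℝ)) : Continuous (blockAdjoint T) := by
  unfold blockAdjoint
  fun_prop

theorem inner_blockAdjoint {m n d : ℕ} (T : EuclideanSpace ℝ (Fin d) →ₗ[ℝ] (Fin n × Fin m → ℝ))
    (x : Fin n → Fin m → ℝ) (y : EuclideanSpace ℝ (Fin d)) :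
    inner ℝ (blockAdjoint T x) y = ∑ i, ∑ j, x i j * T y (i, j) := by
  set b := EuclideanSpace.basisFun (Fin d) ℝ with hb
  conv_rhs => rw [← b.sum_repr' y]
  simp only [blockAdjoint, sum_inner, real_inner_smul_left, map_sum, map_smul, Finset.sum_apply,
    Pi.smul_apply, smul_eq_mul, Finset.mul_sum, Finset.sum_mul, ← hb]
  rw [Finset.sum_comm]
  refine Finset.sum_congr rfl fun i _ => ?_
  rw [Finset.sum_comm]
  exact Finset.sum_congr rfl fun j _ => Finset.sum_congr rfl fun c _ => by ring

theorem map_blockAdjoint {m n d : ℕ} {θ : Fin n → ℝ} (hθ : ∑ i, θ i ^ 2 = 1)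
    {T : EuclideanSpace ℝ (Fin d) →ₗ[ℝ] (Fin n × Fin m → ℝ)}
    (hT : ∀ y, ∑ c, T y c ^ 2 = ∑ i, y i ^ 2) (hTr : Set.range T = blockHyp m n θ)
    (x : Fin n → Fin m → ℝ) (i : Fin n) (j : Fin m) :
    T (blockAdjoint T x) (i, j) = shrinkMap 1 θ x i j := by
  have hmem : (fun c : Fin n × Fin m => shrinkMap 1 θ x c.1 c.2) ∈ blockHyp m n θ := fun j => by
    rw [sum_mul_shrinkMap 1 hθ, sub_self, zero_mul]
  obtain ⟨z, hz⟩ := hTr ▸ hmem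
  have hzx : blockAdjoint T x = z := by
    refine ext_inner_right ℝ fun y => ?_
    have hy : T y ∈ blockHyp m n θ := hTr ▸ Set.mem_range_self y
    rw [inner_blockAdjoint, ← sum_mul_eq_inner_of_isometry hT, hz, Fintype.sum_prod_type]
    have h : ∀ i j, shrinkMap 1 θ x i j * T y (i, j) =
        x i j * T y (i, j) - (∑ k, θ k * x k j) * (θ i * T y (i, j)) := fun i j => by
      rw [shrinkMap_apply]; ring
    simp only [h, Finset.sum_sub_distrib]
    rw [Finset.sum_comm (f := fun i j => (∑ k, θ k * x k j) * (θ i * T y (i, j)))]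
    simp only [← Finset.mul_sum]
    have h0 : ∀ j, ∑ i, θ i * T y (i, j) = 0 := hy
    simp only [h0, mul_zero, Finset.sum_const_zero, sub_zero]
  rw [hzx, hz]

theorem gaussMeasure_map_blockAdjoint {m n d : ℕ}
    {T : EuclideanSpace ℝ (Fin d) →ₗ[ℝ] (Fin n × Fin m → ℝ)}
    (hT : ∀ y, ∑ c, T y c ^ 2 = ∑ i, y i ^ 2) :
    (gaussMeasure m n).map (blockAdjoint T) = ENNReal.ofReal (((2 * π) ^ ((m : ℝ) / 2)) ^ n) •
      ProbabilityTheory.stdGaussian (EuclideanSpace ℝ (Fin d)) := by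
  have : IsFiniteMeasure (ENNReal.ofReal (((2 * π) ^ ((m : ℝ) / 2)) ^ n) •
      ProbabilityTheory.stdGaussian (EuclideanSpace ℝ (Fin d))) :=
    ⟨by rw [Measure.smul_apply]
        exact ENNReal.mul_lt_top ENNReal.ofReal_lt_top (measure_lt_top _ _)⟩
  refine Measure.ext_of_charFun (funext fun y => ?_)
  have hr : charFun (ENNReal.ofReal (((2 * π) ^ ((m : ℝ) / 2)) ^ n) •
      ProbabilityTheory.stdGaussian (EuclideanSpace ℝ (Fin d))) y =
      ((((2 * π) ^ ((m : ℝ) / 2)) ^ n * rexp (-(1 / 2) * ∑ i, y i ^ 2) : ℝ) : ℂ) := by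
    rw [charFun_apply, integral_smul_measure, ← charFun_apply,
      ProbabilityTheory.charFun_stdGaussian, ENNReal.toReal_ofReal (by positivity),
      Complex.real_smul, Complex.ofReal_mul, Complex.ofReal_exp,
      ← EuclideanSpace.real_norm_sq_eq]
    congr 2
    push_cast
    ring
  rw [hr, charFun_apply, integral_map (continuous_blockAdjoint T).aemeasurable (by fun_prop),
    integral_gaussMeasure]
  have hprod : ∀ x : Fin n → Fin m → ℝ, (∏ i, gaussWeight (x i)) •
      Complex.exp ((inner ℝ (blockAdjoint T x) y : ℝ) * Complex.I) =
      ∏ i, ((gaussWeight (x i) : ℂ) *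
        Complex.exp ((∑ j, T y (i, j) * x i j : ℝ) * Complex.I)) := by
    intro x
    rw [Finset.prod_mul_distrib, ← Complex.exp_sum, ← Finset.sum_mul, ← Complex.ofReal_sum,
      Complex.real_smul, Complex.ofReal_prod, inner_blockAdjoint]
    simp only [mul_comm (x _ _)]
  simp only [hprod]
  rw [integral_fintype_prod_volume_eq_prod (fun i (x : Fin m → ℝ) => (gaussWeight x : ℂ) *
    Complex.exp ((∑ j, T y (i, j) * x j : ℝ) * Complex.I))]
  simp only [integral_gaussWeight_mul_cexp fun j => T y (_, j)]
  rw [← Complex.ofReal_prod, Finset.prod_mul_distrib, Finset.prod_const, Finset.card_univ,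
    Fintype.card_fin, Fintype.card_fin]
  simp only [gaussWeight]
  rw [← Real.exp_sum, ← Finset.mul_sum, ← hT, Fintype.sum_prod_type]

theorem integral_shrinkMap_one_eq {m n d : ℕ} {θ : Fin n → ℝ} (hθ : ∑ i, θ i ^ 2 = 1)
    {T : EuclideanSpace ℝ (Fin d) →ₗ[ℝ] (Fin n × Fin m → ℝ)}
    (hT : ∀ y, ∑ c, T y c ^ 2 = ∑ i, y i ^ 2) (hTr : Set.range T = blockHyp m n θ)
    {Ψ : (Fin n → Fin m → ℝ) → ℝ} (hΨ : Continuous Ψ) :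
    ∫ x, Ψ (shrinkMap 1 θ x) ∂gaussMeasure m n = ((2 * π) ^ ((m : ℝ) / 2)) ^ n *
      ∫ y, Ψ (fun i j => T y (i, j))
        ∂ProbabilityTheory.stdGaussian (EuclideanSpace ℝ (Fin d)) := by
  have hTc : Continuous T := T.continuous_of_finiteDimensional
  have hc : Continuous fun y => Ψ (fun i j => T y (i, j)) := by fun_prop
  have h := integral_map (μ := gaussMeasure m n) (continuous_blockAdjoint T).aemeasurable
    hc.aestronglyMeasurable
  rw [gaussMeasure_map_blockAdjoint hT, integral_smul_measure,
    ENNReal.toReal_ofReal (by positivity), smul_eq_mul] at h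
  rw [h]
  simp only [map_blockAdjoint hθ hT hTr]

theorem sum_sq_sphere {m : ℕ} (u : Metric.sphere (0 : EuclideanSpace ℝ (Fin m)) 1) :
    ∑ k, (u : EuclideanSpace ℝ (Fin m)) k ^ 2 = 1 := by
  rw [← EuclideanSpace.real_norm_sq_eq, norm_eq_of_mem_sphere u, one_pow]

theorem IsIsotropic.isFiniteMeasure {m : ℕ}
    {μ : Measure (Metric.sphere (0 : EuclideanSpace ℝ (Fin m)) 1)} (hiso : IsIsotropic m μ) :
    IsFiniteMeasure μ := by
  have hint : ∀ k, Integrable (fun u : Metric.sphere (0 : EuclideanSpace ℝ (Fin m)) 1 =>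
      (u : EuclideanSpace ℝ (Fin m)) k ^ 2) μ := fun k => by
    by_contra h
    have h1 := hiso (Pi.single k 1)
    simp [Pi.single_apply, integral_undef h] at h1
  have h1 := integrable_finsetSum Finset.univ fun k _ => hint k
  simp only [sum_sq_sphere] at h1
  simpa using integrable_const_iff.1 h1

theorem sum_mul_sphere_sq_le {m : ℕ} (x : Fin m → ℝ)
    (u : Metric.sphere (0 : EuclideanSpace ℝ (Fin m)) 1) :
    (∑ k, x k * (u : EuclideanSpace ℝ (Fin m)) k) ^ 2 ≤ ∑ k, x k ^ 2 := by
  have h := Finset.sum_mul_sq_le_sq_mul_sq Finset.univ x (u : EuclideanSpace ℝ (Fin m))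
  rwa [sum_sq_sphere, mul_one] at h

theorem lewisNorm_nonneg {m : ℕ} (p : ℝ)
    (μ : Measure (Metric.sphere (0 : EuclideanSpace ℝ (Fin m)) 1)) (x : Fin m → ℝ) :
    0 ≤ lewisNorm m p μ x :=
  Real.rpow_nonneg (lewisPow_nonneg p μ x) _

theorem lewisNorm_rpow {m : ℕ} {p : ℝ} (hp : 0 < p)
    (μ : Measure (Metric.sphere (0 : EuclideanSpace ℝ (Fin m)) 1)) (x : Fin m → ℝ) :
    lewisNorm m p μ x ^ p = lewisPow p μ x := by
  change (lewisPow p μ x ^ (1 / p)) ^ p = lewisPow p μ x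
  rw [← Real.rpow_mul (lewisPow_nonneg p μ x), one_div_mul_cancel hp.ne', Real.rpow_one]

theorem lewisPow_smul {m : ℕ} (p : ℝ)
    (μ : Measure (Metric.sphere (0 : EuclideanSpace ℝ (Fin m)) 1)) (r : ℝ) (x : Fin m → ℝ) :
    lewisPow p μ (r • x) = |r| ^ p * lewisPow p μ x := by
  simp only [lewisPow, Pi.smul_apply, smul_eq_mul, mul_assoc, ← Finset.mul_sum, abs_mul,
    Real.mul_rpow (abs_nonneg _) (abs_nonneg _), integral_const_mul]

theorem lewisNorm_smul {m : ℕ} {p : ℝ} (hp : 0 < p)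
    (μ : Measure (Metric.sphere (0 : EuclideanSpace ℝ (Fin m)) 1)) (r : ℝ) (x : Fin m → ℝ) :
    lewisNorm m p μ (r • x) = |r| * lewisNorm m p μ x := by
  change lewisPow p μ (r • x) ^ (1 / p) = |r| * lewisPow p μ x ^ (1 / p)
  rw [lewisPow_smul, Real.mul_rpow (Real.rpow_nonneg (abs_nonneg _) _) (lewisPow_nonneg p μ x),
    ← Real.rpow_mul (abs_nonneg _), mul_one_div_cancel hp.ne', Real.rpow_one]

theorem IsIsotropic.sqrt_sum_sq_le_lewisNorm {m : ℕ}
    {μ : Measure (Metric.sphere (0 : EuclideanSpace ℝ (Fin m)) 1)} (hiso : IsIsotropic m μ)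
    {p : ℝ} (hp : 0 < p) (hp2 : p ≤ 2) (x : Fin m → ℝ) :
    √(∑ k, x k ^ 2) ≤ lewisNorm m p μ x := by
  have := hiso.isFiniteMeasure
  set s := √(∑ k, x k ^ 2) with hs
  have hs0 : 0 ≤ s := Real.sqrt_nonneg _
  rcases hs0.eq_or_lt with h0 | h0
  · rw [← h0]
    exact lewisNorm_nonneg p μ x
  have hsq : s ^ 2 = ∑ k, x k ^ 2 := Real.sq_sqrt (Finset.sum_nonneg fun k _ => sq_nonneg _)
  have hle : s ^ 2 ≤ s ^ (2 - p) * lewisPow p μ x := by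
    rw [hsq, hiso x, lewisPow, ← integral_const_mul]
    refine integral_mono_of_nonneg (Eventually.of_forall fun u => sq_nonneg _)
      ((integrable_abs_sum_mul_sphere_rpow hp.le μ x).const_mul _)
      (Eventually.of_forall fun u => ?_)
    simp only
    set t := ∑ k, x k * (u : EuclideanSpace ℝ (Fin m)) k
    have hts : |t| ≤ s := Real.abs_le_sqrt (sum_mul_sphere_sq_le x u)
    have h2 : t ^ 2 = |t| ^ (2 - p) * |t| ^ p := by
      rw [← Real.rpow_add_of_nonneg (abs_nonneg _) (by linarith) hp.le, sub_add_cancel,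
        Real.rpow_two, sq_abs]
    rw [h2]
    gcongr
  have h2 : s ^ 2 = s ^ (2 - p) * s ^ p := by
    rw [← Real.rpow_add h0, sub_add_cancel, Real.rpow_two]
  rw [h2] at hle
  have h3 := le_of_mul_le_mul_left hle (Real.rpow_pos_of_pos h0 _)
  rw [← lewisNorm_rpow hp] at h3
  exact (Real.rpow_le_rpow_iff hs0 (lewisNorm_nonneg p μ x) hp).1 h3

theorem IsIsotropic.bddAbove_dualNorm {m : ℕ}
    {μ : Measure (Metric.sphere (0 : EuclideanSpace ℝ (Fin m)) 1)} (hiso : IsIsotropic m μ)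
    {p : ℝ} (hp : 0 < p) (hp2 : p ≤ 2) (y : Fin m → ℝ) :
    BddAbove ((fun x => ∑ k, x k * y k) '' {x | lewisNorm m p μ x ≤ 1}) := by
  refine ⟨√(∑ k, y k ^ 2), ?_⟩
  rintro _ ⟨x, hx, rfl⟩
  refine (Real.sum_mul_le_sqrt_mul_sqrt _ _ _).trans ?_
  exact mul_le_of_le_one_left (Real.sqrt_nonneg _)
    ((hiso.sqrt_sum_sq_le_lewisNorm hp hp2 x).trans hx)

theorem lewisNorm_zero {m : ℕ} {p : ℝ} (hp : 0 < p)
    (μ : Measure (Metric.sphere (0 : EuclideanSpace ℝ (Fin m)) 1)) : lewisNorm m p μ 0 = 0 := by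
  simpa using lewisNorm_smul hp μ 0 0

theorem IsIsotropic.dualNorm_nonneg {m : ℕ}
    {μ : Measure (Metric.sphere (0 : EuclideanSpace ℝ (Fin m)) 1)} (hiso : IsIsotropic m μ)
    {p : ℝ} (hp : 0 < p) (hp2 : p ≤ 2) (y : Fin m → ℝ) :
    0 ≤ dualNorm m (lewisNorm m p μ) y :=
  le_csSup (hiso.bddAbove_dualNorm hp hp2 y)
    ⟨0, by simp [lewisNorm_zero hp], by simp⟩

theorem IsIsotropic.sum_mul_le_dualNorm_mul {m : ℕ}
    {μ : Measure (Metric.sphere (0 : EuclideanSpace ℝ (Fin m)) 1)} (hiso : IsIsotropic m μ)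
    {p : ℝ} (hp : 0 < p) (hp2 : p ≤ 2) (y x : Fin m → ℝ) :
    ∑ k, y k * x k ≤ dualNorm m (lewisNorm m p μ) y * lewisNorm m p μ x := by
  set N := lewisNorm m p μ x with hN
  rcases (lewisNorm_nonneg p μ x).eq_or_lt with h0 | h0
  · have h := hiso.sqrt_sum_sq_le_lewisNorm hp hp2 x
    have h1 := Real.sum_mul_le_sqrt_mul_sqrt Finset.univ y x
    rw [← hN] at h h0
    rw [← h0] at h ⊢
    rwa [le_antisymm h (Real.sqrt_nonneg _), mul_zero, ← mul_zero (dualNorm m _ y)] at h1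
  · rw [← div_le_iff₀ h0]
    refine le_csSup (hiso.bddAbove_dualNorm hp hp2 y) ⟨N⁻¹ • x, ?_, ?_⟩
    · rw [Set.mem_ofPred_eq, lewisNorm_smul hp, abs_of_pos (inv_pos.2 h0), inv_mul_cancel₀ h0.ne']
    · simp only [Pi.smul_apply, smul_eq_mul, mul_assoc, ← Finset.mul_sum]
      simp only [mul_comm (x _), div_eq_inv_mul, hN]

/-- The gradient of `lewisPow p μ / p`, a functional norming `x` up to scaling. -/
def lewisGrad {m : ℕ} (p : ℝ) (μ : Measure (Metric.sphere (0 : EuclideanSpace ℝ (Fin m)) 1))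
    (x : Fin m → ℝ) (k : Fin m) : ℝ :=
  ∫ u, SignType.sign (∑ k, x k * (u : EuclideanSpace ℝ (Fin m)) k) *
    |∑ k, x k * (u : EuclideanSpace ℝ (Fin m)) k| ^ (p - 1) * (u : EuclideanSpace ℝ (Fin m)) k ∂μ

theorem abs_sign_le_one (t : ℝ) : |(SignType.sign t : ℝ)| ≤ 1 := by
  cases SignType.sign t <;> simp

theorem integrable_sign_mul_rpow_mul {m : ℕ} {p : ℝ} (hp : 1 ≤ p)
    (μ : Measure (Metric.sphere (0 : EuclideanSpace ℝ (Fin m)) 1)) [IsFiniteMeasure μ]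
    (x y : Fin m → ℝ) :
    Integrable (fun u : Metric.sphere (0 : EuclideanSpace ℝ (Fin m)) 1 =>
      (SignType.sign (∑ k, x k * (u : EuclideanSpace ℝ (Fin m)) k) : ℝ) *
        |∑ k, x k * (u : EuclideanSpace ℝ (Fin m)) k| ^ (p - 1) *
          ∑ k, y k * (u : EuclideanSpace ℝ (Fin m)) k) μ := by
  have hc : ∀ y : Fin m → ℝ, Continuous fun u : Metric.sphere (0 : EuclideanSpace ℝ (Fin m)) 1 =>
      ∑ k, y k * (u : EuclideanSpace ℝ (Fin m)) k := fun y => by fun_prop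
  have hsign : Measurable fun t : ℝ => (SignType.sign t : ℝ) := by
    have : (fun t : ℝ => (SignType.sign t : ℝ)) =
        fun t => if 0 < t then 1 else if t < 0 then -1 else 0 := by
      ext t
      rw [sign_apply]
      split_ifs <;> simp
    rw [this]
    exact Measurable.ite measurableSet_Ioi measurable_const
      (Measurable.ite measurableSet_Iio measurable_const measurable_const)
  refine Integrable.of_bound (C := (m * ‖x‖) ^ (p - 1) * (m * ‖y‖)) ?_
    (Eventually.of_forall fun u => ?_)
  · exact (((hsign.comp (hc x).measurable).mul ((hc x).abs.measurable.pow_const _)).mul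
      (hc y).measurable).aestronglyMeasurable
  · rw [norm_mul, norm_mul, Real.norm_eq_abs, Real.norm_eq_abs, Real.norm_eq_abs,
      abs_of_nonneg (Real.rpow_nonneg (abs_nonneg _) (p - 1))]
    calc _ ≤ 1 * (m * ‖x‖) ^ (p - 1) * (m * ‖y‖) := by
          gcongr
          · exact abs_sign_le_one _
          · exact abs_sum_mul_sphere_le x u
          · exact abs_sum_mul_sphere_le y u
      _ = _ := by rw [one_mul]

theorem sum_mul_lewisGrad {m : ℕ} {p : ℝ} (hp : 1 ≤ p)
    (μ : Measure (Metric.sphere (0 : EuclideanSpace ℝ (Fin m)) 1)) [IsFiniteMeasure μ]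
    (x y : Fin m → ℝ) :
    ∑ k, y k * lewisGrad p μ x k =
      ∫ u, SignType.sign (∑ k, x k * (u : EuclideanSpace ℝ (Fin m)) k) *
        |∑ k, x k * (u : EuclideanSpace ℝ (Fin m)) k| ^ (p - 1) *
          ∑ k, y k * (u : EuclideanSpace ℝ (Fin m)) k ∂μ := by
  simp only [lewisGrad, ← integral_const_mul]
  rw [← integral_finsetSum]
  · refine integral_congr_ae (Eventually.of_forall fun u => ?_)
    simp only [Finset.mul_sum]
    exact Finset.sum_congr rfl fun k _ => by ring
  · intro k _
    refine Integrable.const_mul ?_ _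
    simpa [Pi.single_apply] using integrable_sign_mul_rpow_mul hp μ x (Pi.single k 1)

theorem sum_mul_lewisGrad_self {m : ℕ} {p : ℝ} (hp : 1 ≤ p)
    (μ : Measure (Metric.sphere (0 : EuclideanSpace ℝ (Fin m)) 1)) [IsFiniteMeasure μ]
    (x : Fin m → ℝ) : ∑ k, x k * lewisGrad p μ x k = lewisPow p μ x := by
  rw [sum_mul_lewisGrad hp, lewisPow]
  refine integral_congr_ae (Eventually.of_forall fun u => ?_)
  simp only
  rw [mul_right_comm, sign_mul_self]
  nth_rewrite 1 [← Real.rpow_one |_|]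
  rw [← Real.rpow_add_of_nonneg (abs_nonneg _) zero_le_one (by linarith), add_sub_cancel]

theorem sum_mul_lewisGrad_le {m : ℕ} {p : ℝ} (hp : 1 ≤ p)
    (μ : Measure (Metric.sphere (0 : EuclideanSpace ℝ (Fin m)) 1)) [IsFiniteMeasure μ]
    (x y : Fin m → ℝ) :
    ∑ k, y k * lewisGrad p μ x k ≤ lewisNorm m p μ x ^ (p - 1) * lewisNorm m p μ y := by
  have hp0 : 0 < p := by linarith
  have hc : ∀ y : Fin m → ℝ, Continuous fun u : Metric.sphere (0 : EuclideanSpace ℝ (Fin m)) 1 =>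
      |∑ k, y k * (u : EuclideanSpace ℝ (Fin m)) k| := fun y => by fun_prop
  have hcp : Continuous fun u : Metric.sphere (0 : EuclideanSpace ℝ (Fin m)) 1 =>
      |∑ k, x k * (u : EuclideanSpace ℝ (Fin m)) k| ^ (p - 1) :=
    (hc x).rpow_const fun _ => Or.inr (by linarith)
  have hle : ∑ k, y k * lewisGrad p μ x k ≤
      ∫ u, |∑ k, x k * (u : EuclideanSpace ℝ (Fin m)) k| ^ (p - 1) *
        |∑ k, y k * (u : EuclideanSpace ℝ (Fin m)) k| ∂μ := by
    rw [sum_mul_lewisGrad hp]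
    refine integral_mono (integrable_sign_mul_rpow_mul hp μ x y)
      ((hcp.mul (hc y)).integrable_of_hasCompactSupport (HasCompactSupport.of_compactSpace _))
      fun u => (le_abs_self _).trans ?_
    simp only
    rw [abs_mul, abs_mul, abs_of_nonneg (Real.rpow_nonneg (abs_nonneg _) (p - 1))]
    refine mul_le_mul_of_nonneg_right (mul_le_of_le_one_left (by positivity) (abs_sign_le_one _))
      (abs_nonneg _)
  refine hle.trans ?_
  rcases hp.eq_or_lt with rfl | hp1
  · simp [lewisNorm]
  · have hq : (p / (p - 1)).HolderConjugate p := (Real.HolderConjugate.conjExponent hp1).symm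
    have hmem : ∀ (r : ℝ≥0∞) {f : Metric.sphere (0 : EuclideanSpace ℝ (Fin m)) 1 → ℝ},
        Continuous f → MemLp f r μ := fun r f hf =>
      hf.memLp_of_hasCompactSupport (HasCompactSupport.of_compactSpace _)
    refine (integral_mul_le_Lp_mul_Lq_of_nonneg hq
      (Eventually.of_forall fun u => Real.rpow_nonneg (abs_nonneg _) _)
      (Eventually.of_forall fun u => abs_nonneg _) (hmem _ hcp) (hmem _ (hc y))).trans_eq ?_
    congr 1
    simp only [← Real.rpow_mul (abs_nonneg _), mul_div_cancel₀ p (sub_pos.2 hp1).ne']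
    change lewisPow p μ x ^ (1 / (p / (p - 1))) = (lewisPow p μ x ^ (1 / p)) ^ (p - 1)
    rw [← Real.rpow_mul (lewisPow_nonneg p μ x)]
    congr 1
    rw [one_div_div]
    ring

theorem IsIsotropic.dualNorm_smul_lewisGrad_le {m : ℕ}
    {μ : Measure (Metric.sphere (0 : EuclideanSpace ℝ (Fin m)) 1)} (hiso : IsIsotropic m μ)
    {p : ℝ} (hp : 1 ≤ p) {r : ℝ} (hr : 0 ≤ r) (x : Fin m → ℝ) :
    dualNorm m (lewisNorm m p μ) (r • lewisGrad p μ x) ≤ r * lewisNorm m p μ x ^ (p - 1) := by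
  have := hiso.isFiniteMeasure
  have hp0 : 0 < p := by linarith
  refine csSup_le ⟨0, 0, by simp [lewisNorm_zero hp0], by simp⟩ ?_
  rintro _ ⟨y, hy, rfl⟩
  simp only [Pi.smul_apply, smul_eq_mul, mul_left_comm _ r, ← Finset.mul_sum]
  refine mul_le_mul_of_nonneg_left ((sum_mul_lewisGrad_le hp μ x y).trans ?_) hr
  exact mul_le_of_le_one_right (Real.rpow_nonneg (lewisNorm_nonneg p μ x) _) hy

theorem IsIsotropic.isGreatest_sum_mul_lqBallE {m n : ℕ}
    {μ : Measure (Metric.sphere (0 : EuclideanSpace ℝ (Fin m)) 1)} (hiso : IsIsotropic m μ)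
    {p : ℝ} (hp : 1 ≤ p) (hp2 : p ≤ 2) {q : ℝ≥0∞} (hq : q ≠ 0)
    (hpq : 1 / p + 1 / q.toReal = 1) (u : Fin n × Fin m → ℝ) :
    IsGreatest ((fun x => ∑ c, x c * u c) '' lqBallE m n q (dualNorm m (lewisNorm m p μ)))
      ((∑ i, lewisPow p μ fun j => u (i, j)) ^ (1 / p)) := by
  have := hiso.isFiniteMeasure
  have hp0 : 0 < p := by linarith
  set L : Fin n → ℝ := fun i => lewisPow p μ fun j => u (i, j) with hL
  have hL0 : ∀ i, 0 ≤ L i := fun i => lewisPow_nonneg p μ _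
  set S := ∑ i, L i with hS
  have hS0 : 0 ≤ S := Finset.sum_nonneg fun i _ => hL0 i
  set N : Fin n → ℝ := fun i => lewisNorm m p μ fun j => u (i, j) with hN
  have hN0 : ∀ i, 0 ≤ N i := fun i => lewisNorm_nonneg p μ _
  have hNL : ∀ i, N i ^ p = L i := fun i => lewisNorm_rpow hp0 μ _
  have hD0 := hiso.dualNorm_nonneg hp0 hp2
  constructor
  · set r := S ^ (-((p - 1) / p)) with hr
    have hr0 : 0 ≤ r := Real.rpow_nonneg hS0 _
    have hle := fun i => hiso.dualNorm_smul_lewisGrad_le hp hr0 fun j => u (i, j)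
    refine ⟨fun c => (r • lewisGrad p μ fun j => u (c.1, j)) c.2, ?_, ?_⟩
    · rw [lqBallE]
      split_ifs with hqt
      · have hp1 : p = 1 := by simpa [hqt] using hpq
        intro i
        refine (hle i).trans_eq ?_
        simp [hr, hp1]
      · have hq0 : 0 < q.toReal := ENNReal.toReal_pos hq hqt
        have hpq' : (p - 1) * q.toReal = p := by
          field_simp at hpq
          linarith
        have hi : ∀ i, dualNorm m (lewisNorm m p μ) (r • lewisGrad p μ fun j => u (i, j)) ^
            q.toReal ≤ r ^ q.toReal * L i := fun i => by
          refine (Real.rpow_le_rpow (hD0 _) (hle i) hq0.le).trans_eq ?_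
          rw [Real.mul_rpow hr0 (Real.rpow_nonneg (hN0 i) _), ← Real.rpow_mul (hN0 i), hpq', hNL]
        refine (Finset.sum_le_sum fun i _ => hi i).trans ?_
        rw [← Finset.mul_sum, ← hS, hr, ← Real.rpow_mul hS0, neg_mul, div_mul_eq_mul_div, hpq',
          div_self hp0.ne', Real.rpow_neg_one]
        exact inv_mul_le_one
    · have hx : ∀ i, ∑ j, (r • lewisGrad p μ fun j => u (i, j)) j * u (i, j) = r * L i := by
        intro i
        simp only [hL]
        rw [← sum_mul_lewisGrad_self hp, Finset.mul_sum]
        exact Finset.sum_congr rfl fun j _ => by rw [Pi.smul_apply, smul_eq_mul]; ring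
      simp only [Fintype.sum_prod_type, hx]
      rw [← Finset.mul_sum, ← hS]
      rcases hS0.eq_or_lt with h0 | h0
      · rw [← h0, mul_zero, Real.zero_rpow (one_div_pos.2 hp0).ne']
      · rw [hr, ← Real.rpow_add_one h0.ne']
        congr 1
        field_simp
        ring
  · rintro _ ⟨x, hx, rfl⟩
    rw [lqBallE] at hx
    simp only [Fintype.sum_prod_type]
    refine (Finset.sum_le_sum fun i _ =>
      hiso.sum_mul_le_dualNorm_mul hp0 hp2 (fun j => x (i, j)) fun j => u (i, j)).trans ?_
    split_ifs at hx with hqt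
    · have hp1 : p = 1 := by simpa [hqt] using hpq
      refine (Finset.sum_le_sum fun i _ => mul_le_of_le_one_left (hN0 i) (hx i)).trans_eq ?_
      simp only [hS, ← hNL, hp1, Real.rpow_one, div_one]
    · have hq0 : 0 < q.toReal := ENNReal.toReal_pos hq hqt
      have hconj : q.toReal.HolderConjugate p :=
        ⟨by rw [inv_one, ← hpq, one_div, one_div, add_comm], hq0, hp0⟩
      refine (Real.inner_le_Lp_mul_Lq_of_nonneg Finset.univ hconj (fun i _ => hD0 _)
        fun i _ => hN0 i).trans ?_
      simp only [hNL]
      exact mul_le_of_le_one_left (Real.rpow_nonneg hS0 _) (Real.rpow_le_one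
        (Finset.sum_nonneg fun i _ => Real.rpow_nonneg (hD0 _) _) hx (one_div_nonneg.2 hq0.le))

theorem IsIsotropic.sSup_sum_mul_projection {m n : ℕ}
    {μ : Measure (Metric.sphere (0 : EuclideanSpace ℝ (Fin m)) 1)} (hiso : IsIsotropic m μ)
    {p : ℝ} (hp : 1 ≤ p) (hp2 : p ≤ 2) {q : ℝ≥0∞} (hq : q ≠ 0)
    (hpq : 1 / p + 1 / q.toReal = 1) {P : (Fin n × Fin m → ℝ) → Fin n × Fin m → ℝ}
    {u : Fin n × Fin m → ℝ} (hP : ∀ x, ∑ c, (x c - P x c) * u c = 0) :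
    sSup ((fun x => ∑ c, x c * u c) '' (P '' lqBallE m n q (dualNorm m (lewisNorm m p μ)))) =
      (∑ i, lewisPow p μ fun j => u (i, j)) ^ (1 / p) := by
  rw [Set.image_image, ← (hiso.isGreatest_sum_mul_lqBallE hp hp2 hq hpq u).csSup_eq]
  congr 2
  ext x
  have h := hP x
  simp only [sub_mul, Finset.sum_sub_distrib] at h
  linarith

theorem one_le_and_le_two_of_conjugate {p : ℝ} {q : ℝ≥0∞} (hq : 2 ≤ q)
    (hpq : 1 / p + 1 / q.toReal = 1) : 1 ≤ p ∧ p ≤ 2 := by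
  have hq' : 1 / q.toReal ≤ 1 / 2 := by
    rcases eq_or_ne q ⊤ with rfl | hqt
    · norm_num
    · have h2 : (2 : ℝ) ≤ q.toReal := by
        simpa using ENNReal.toReal_mono hqt hq
      exact one_div_le_one_div_of_le two_pos h2
  have hp0 : 0 < p := one_div_pos.1 (by linarith)
  have h0 : 0 ≤ 1 / q.toReal := one_div_nonneg.2 ENNReal.toReal_nonneg
  constructor
  · have : 1 / p ≤ 1 := by linarith
    rwa [div_le_one hp0] at this
  · have : 1 / 2 ≤ 1 / p := by linarith
    rwa [one_div_le_one_div two_pos hp0] at this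

/-- **Corollary (mean width of projections).** Let `q ∈ [2,∞]`, `1/p + 1/q = 1`, `μ` an
isotropic measure on `S^{m-1}` and `X = X_p(μ)` (so `B_X` is in Lewis position), with dual
`X*`. If `(θ_1²,…,θ_n²)` is majorized by `(φ_1²,…,φ_n²)`, then
`w(Proj_{H_θ}(B_q^n(X*))) ≥ w(Proj_{H_φ}(B_q^n(X*)))`. Here `Pθ, Pφ` are the orthogonal
projections onto `H_θ, H_φ`, and the mean widths are computed inside the respective
subspaces via Euclidean isometric parametrizations `ιθ, ιφ`. -/
theorem mean_width_projections (m n : ℕ) (q : ℝ≥0∞) (hq : 2 ≤ q) (p : ℝ)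
    (hpq : 1 / p + 1 / q.toReal = 1)
    (μ : Measure (Metric.sphere (0 : EuclideanSpace ℝ (Fin m)) 1)) (hiso : IsIsotropic m μ)
    (θ φ : Fin n → ℝ) (hθ : ∑ i, θ i ^ 2 = 1) (hφ : ∑ i, φ i ^ 2 = 1)
    (hmaj : IsMajorizedBy (fun i => θ i ^ 2) (fun i => φ i ^ 2))
    (Pθ Pφ : (Fin n × Fin m → ℝ) →ₗ[ℝ] (Fin n × Fin m → ℝ))
    (hPθ1 : ∀ x, Pθ x ∈ blockHyp m n θ)
    (hPθ2 : ∀ x, ∀ h ∈ blockHyp m n θ, ∑ c, (x c - Pθ x c) * h c = 0)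
    (hPφ1 : ∀ x, Pφ x ∈ blockHyp m n φ)
    (hPφ2 : ∀ x, ∀ h ∈ blockHyp m n φ, ∑ c, (x c - Pφ x c) * h c = 0)
    (ιθ ιφ : EuclideanSpace ℝ (Fin (m * (n - 1))) →ₗ[ℝ] (Fin n × Fin m → ℝ))
    (hιθn : ∀ y, ∑ c, ιθ y c ^ 2 = ∑ i, y i ^ 2)
    (hιθr : Set.range ⇑ιθ = blockHyp m n θ)
    (hιφn : ∀ y, ∑ c, ιφ y c ^ 2 = ∑ i, y i ^ 2)
    (hιφr : Set.range ⇑ιφ = blockHyp m n φ) :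
    meanWidthIn m n (m * (n - 1)) ιφ
        (⇑Pφ '' lqBallE m n q (dualNorm m (lewisNorm m p μ))) ≤
      meanWidthIn m n (m * (n - 1)) ιθ
        (⇑Pθ '' lqBallE m n q (dualNorm m (lewisNorm m p μ))) := by
  obtain ⟨hp, hp2⟩ := one_le_and_le_two_of_conjugate hq hpq
  have := hiso.isFiniteMeasure
  have hp0 : 0 < p := by linarith
  have hq0 : q ≠ 0 := (two_pos.trans_le hq).ne'
  rcases Nat.eq_zero_or_pos m with rfl | hm
  · have hempty : ∀ ι A, meanWidthIn 0 n (0 * (n - 1)) ι A = 0 := fun ι A => by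
      have : IsEmpty (Fin (0 * (n - 1))) := by rw [zero_mul]; infer_instance
      rw [meanWidthIn, Metric.sphere_eq_empty_of_subsingleton one_ne_zero]
      simp
    rw [hempty, hempty]
  have : Nonempty (Fin m) := ⟨⟨0, hm⟩⟩
  have : Nonempty (Metric.sphere (0 : EuclideanSpace ℝ (Fin m)) 1) :=
    (NormedSpace.sphere_nonempty.2 zero_le_one).to_subtype
  set Ψ : (Fin n → Fin m → ℝ) → ℝ := fun x => (∑ i, lewisPow p μ (x i)) ^ (1 / p) with hΨ
  have hL := continuous_lewisPow hp0.le μ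
  have hΨc : Continuous Ψ :=
    Continuous.rpow_const (by fun_prop) fun _ => Or.inr (one_div_nonneg.2 hp0.le)
  obtain ⟨c, hc, hav⟩ := exists_average_sphere_eq (m * (n - 1))
  have hwidth : ∀ {ψ : Fin n → ℝ} (_ : ∑ i, ψ i ^ 2 = 1)
      {P : (Fin n × Fin m → ℝ) →ₗ[ℝ] (Fin n × Fin m → ℝ)}
      (_ : ∀ x, ∀ h ∈ blockHyp m n ψ, ∑ c, (x c - P x c) * h c = 0)
      {ι : EuclideanSpace ℝ (Fin (m * (n - 1))) →ₗ[ℝ] (Fin n × Fin m → ℝ)}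
      (_ : ∀ y, ∑ c, ι y c ^ 2 = ∑ i, y i ^ 2) (_ : Set.range ⇑ι = blockHyp m n ψ),
      meanWidthIn m n (m * (n - 1)) ι (⇑P '' lqBallE m n q (dualNorm m (lewisNorm m p μ))) =
        2 * (c * ((((2 * π) ^ ((m : ℝ) / 2)) ^ n)⁻¹ *
          ∫ x, Ψ (shrinkMap 1 ψ x) ∂gaussMeasure m n)) := by
    intro ψ hψ P hP ι hι hιr
    have hιc : Continuous ι := ι.continuous_of_finiteDimensional
    rw [integral_shrinkMap_one_eq hψ hι hιr hΨc, inv_mul_cancel_left₀ (by positivity), ← hav,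
      meanWidthIn]
    · congr 2 with u
      exact hiso.sSup_sum_mul_projection hp hp2 hq0 hpq fun x =>
        hP x _ (hιr ▸ Set.mem_range_self u)
    · fun_prop
    · intro r hr y
      have hs : ∀ i, lewisPow p μ (fun j => ι (r • y) (i, j)) =
          r ^ p * lewisPow p μ fun j => ι y (i, j) := fun i => by
        rw [← abs_of_nonneg hr, ← lewisPow_smul, abs_of_nonneg hr, map_smul]
        rfl
      simp only [hΨ, hs]
      rw [← Finset.mul_sum, Real.mul_rpow (Real.rpow_nonneg hr _)
        (Finset.sum_nonneg fun i _ => lewisPow_nonneg p μ _), ← Real.rpow_mul hr,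
        mul_one_div_cancel hp0.ne', Real.rpow_one]
  rw [hwidth hθ hPθ2 hιθn hιθr, hwidth hφ hPφ2 hιφn hιφr]
  have hmain := integral_rpow_sum_lewisPow_le hθ hφ hmaj hp hp2 μ
  gcongr
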